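/- arXiv:1306.3747 — 8 statements merged into one kernel-verified Lean document; each statement's English description precedes it below -/
import Mathlib

section
/- Let A be an abelian group of order n. The proportion of subsets S of A such that Cay(A,S) is a DRR goes to 1 as n → ∞; that is, for every ε > 0 there exists N such that for every abelian group A of order n ≥ N, the number of subsets S ⊆ A for which Cay(A,S) is a DRR is at least (1 − ε)·2^n. -/
/-- The set of automorphisms of the Cayley digraph `Cay(A,S)`:
permutations of `A` preserving the arc relation `(g,h)` is an arc iff `g * h⁻¹ ∈ S`. -/
def cayleyAutSet (A : Type*) [Group A] (S : Set A) : Set (Equiv.Perm A) :=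
  {σ : Equiv.Perm A | ∀ g h : A, g * h⁻¹ ∈ S ↔ σ g * (σ h)⁻¹ ∈ S}

/-- `Cay(A,S)` is a DRR: its automorphisms are exactly the right translations. -/
def IsDRR (A : Type*) [Group A] (S : Set A) : Prop :=
  cayleyAutSet A S = {σ : Equiv.Perm A | ∃ a : A, ∀ x : A, σ x = x * a}


section Structure

variable {A : Type*} [CommGroup A]

/-- The automorphism group as a subgroup of the symmetric group. -/
def cayG (S : Set A) : Subgroup (Equiv.Perm A) where
  carrier := cayleyAutSet A S
  one_mem' := fun g h => Iff.rfl
  mul_mem' := by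
    intro a b ha hb g h
    exact (hb g h).trans (ha (b g) (b h))
  inv_mem' := by
    intro a ha g h
    have := ha (a⁻¹ g) (a⁻¹ h)
    have e : ∀ x, a (a⁻¹ x) = x := fun x => Equiv.apply_symm_apply a x
    rw [e, e] at this
    exact this.symm

/-- Translation. -/
def trP : A →* Equiv.Perm A where
  toFun a := Equiv.mulRight a
  map_one' := by ext x; simp
  map_mul' a b := by ext x; simp [mul_assoc, mul_comm b a]

@[simp] lemma trP_apply (a x : A) : trP a x = x * a := rfl

lemma trP_comm (a b : A) : trP a * trP b = trP b * trP a := by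
  rw [← map_mul, ← map_mul, mul_comm]

lemma trP_inj {a b : A} (h : trP a = trP b) : a = b := by
  have := congrArg (fun f : Equiv.Perm A => f 1) h
  simpa using this

lemma tr0 (g : Equiv.Perm A) : (trP (g 1)⁻¹ * g) 1 = 1 :=
  show g 1 * (g 1)⁻¹ = 1 from mul_inv_cancel _

lemma conj_fix {k : Equiv.Perm A} {b : A} (h : (k * trP b * k⁻¹) 1 = 1) : b = 1 := by
  have : trP b (k⁻¹ 1) = k⁻¹ 1 := by
    apply k.injective
    simpa using h
  simpa using this

lemma isDRR_iff (S : Set A) : IsDRR A S ↔ cayG S ≤ (trP (A := A)).range := by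
  have h0 : {σ : Equiv.Perm A | ∃ a : A, ∀ x : A, σ x = x * a} ⊆ cayleyAutSet A S := by
    rintro σ ⟨a, ha⟩ g h
    rw [ha, ha]
    simp
  constructor
  · intro h σ hσ
    have h1 : σ ∈ cayleyAutSet A S := hσ
    rw [h] at h1
    obtain ⟨a, ha⟩ := h1
    exact ⟨a, by ext x; simp [ha]⟩
  · intro h
    apply Set.Subset.antisymm _ h0
    intro σ hσ
    obtain ⟨a, ha⟩ := h (show σ ∈ cayG S from hσ)
    exact ⟨a, fun x => by rw [← ha]; rfl⟩

lemma trP_le (S : Set A) : (trP (A := A)).range ≤ cayG S := by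
  rintro _ ⟨a, rfl⟩ g h
  simp

lemma struct_group [Finite A] (G : Subgroup (Equiv.Perm A))
    (hcov : (trP (A := A)).range ⋖ G) :
    (∃ φ : MulAut A, φ ≠ 1 ∧ MulAut.toPerm A φ ∈ G) ∨
    ∃ C : Subgroup A, ∃ h ∈ G, h ≠ 1 ∧ h 1 = 1 ∧ (∀ x, x⁻¹ * h x ∈ C) ∧
      ∀ x, ∀ c ∈ C, h (x * c) = h x * c := by
  classical
  have hle := hcov.le
  have hR : ∀ a : A, trP a ∈ G := fun a => hle ⟨a, rfl⟩
  obtain ⟨g0, hg0, hg0'⟩ := SetLike.exists_of_lt hcov.lt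
  by_cases hn : ∃ g ∈ G, g ∉ (trP (A := A)).range ∧ ∀ a : A, g * trP a * g⁻¹ ∈ (trP (A := A)).range
  · left
    obtain ⟨g, hg, hg', hga⟩ := hn
    set σ : Equiv.Perm A := trP (g 1)⁻¹ * g with hσ
    have hσ1 : σ 1 = 1 := tr0 g
    have hσm : ∀ x a, σ (x * a) = σ x * σ a := by
      intro x a
      obtain ⟨b, hb⟩ := hga a
      have h2 : σ * trP a = trP b * σ := by
        rw [hσ, mul_assoc, ← mul_assoc (trP b), trP_comm b, hb]
        simp [mul_assoc]
      have h3 : ∀ x, σ (x * a) = σ x * b := fun x => congrArg (fun f : Equiv.Perm A => f x) h2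
      have h4 := h3 1
      rw [one_mul, hσ1, one_mul] at h4
      rw [h3, h4]
    refine ⟨MulEquiv.mk σ hσm, ?_, ?_⟩
    · intro h
      apply hg'
      refine ⟨g 1, ?_⟩
      have : σ = 1 := by
        ext x
        exact congrArg (fun f : MulAut A => f x) h
      rw [hσ, map_inv, inv_mul_eq_one] at this
      exact this
    · exact G.mul_mem (hR _) hg
  · right
    push Not at hn
    -- the center
    let C : Subgroup A := (Subgroup.centralizer (G : Set (Equiv.Perm A))).comap trP
    have hC : ∀ c ∈ C, ∀ g ∈ G, g * trP c = trP c * g := by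
      intro c hc g hg
      exact Subgroup.mem_centralizer_iff.1 hc g hg
    have key : ∀ t ∈ G, ∀ a b : A, t * trP a * t⁻¹ = trP b → b ∉ C → t ∈ (trP (A := A)).range := by
      intro t ht a b hab hb
      by_contra htA
      apply hb
      obtain ⟨e, he⟩ := hn t ht htA
      have hcent : (trP (A := A)).range < G ⊓ Subgroup.centralizer {trP b} := by
        refine lt_of_le_of_ne (le_inf hle ?_) ?_
        · rintro _ ⟨x, rfl⟩
          rw [Subgroup.mem_centralizer_singleton_iff]
          exact trP_comm _ _
        · intro heq
          apply he
          rw [heq]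
          refine ⟨G.mul_mem (G.mul_mem ht (hR _)) (G.inv_mem ht), ?_⟩
          show _ ∈ Subgroup.centralizer _
          rw [Subgroup.mem_centralizer_singleton_iff, ← hab]
          have := trP_comm e a
          calc t * trP e * t⁻¹ * (t * trP a * t⁻¹) = t * (trP e * trP a) * t⁻¹ := by group
            _ = t * (trP a * trP e) * t⁻¹ := by rw [this]
            _ = _ := by group
      have hGe : G ⊓ Subgroup.centralizer {trP b} = G := by
        by_contra hne
        exact hcov.2 hcent (lt_of_le_of_ne inf_le_left hne)
      show trP b ∈ Subgroup.centralizer _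
      rw [Subgroup.mem_centralizer_iff]
      intro g hg
      have : g ∈ G ⊓ Subgroup.centralizer {trP b} := by rw [hGe]; exact hg
      exact Subgroup.mem_centralizer_singleton_iff.1 this.2
    let Φ : G → G := fun g => if (g : Equiv.Perm A) 1 ∈ C then g else
      g * ⟨trP ((g : Equiv.Perm A) 1), hR _⟩ * g⁻¹
    have mixed : ∀ g ∈ G, ∀ k ∈ G, (g 1 ∈ C) → k 1 ∉ C →
        g ≠ k * trP (k 1) * k⁻¹ := by
      intro g hg k hk h1 h2 h3
      have h4 : (k * trP (k 1 * (g 1)⁻¹) * k⁻¹) 1 = 1 := by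
        have : k * trP (k 1 * (g 1)⁻¹) * k⁻¹ = trP (g 1)⁻¹ * g := by
          rw [← hC _ (C.inv_mem h1) g hg, map_mul, ← mul_assoc, mul_assoc _ (trP (g 1)⁻¹),
            ← hC _ (C.inv_mem h1) _ (G.inv_mem hk), ← mul_assoc, ← h3]
        rw [this]
        exact tr0 g
      have h5 := conj_fix h4
      rw [mul_inv_eq_one] at h5
      exact h2 (h5 ▸ h1)
    have hinj : Function.Injective Φ := by
      rintro ⟨g, hg⟩ ⟨k, hk⟩ hgk
      by_cases h1 : g 1 ∈ C <;> by_cases h2 : k 1 ∈ C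
      · simpa [Φ, h1, h2] using hgk
      · exfalso
        simp only [Φ, h1, h2, if_true, if_false] at hgk
        exact mixed g hg k hk h1 h2 (congrArg Subtype.val hgk)
      · exfalso
        simp only [Φ, h1, h2, if_true, if_false] at hgk
        exact mixed k hk g hg h2 h1 (congrArg Subtype.val hgk).symm
      · simp only [Φ, h1, h2, if_false] at hgk
        have h3 : g * trP (g 1) * g⁻¹ = k * trP (k 1) * k⁻¹ := congrArg Subtype.val hgk
        have h4 : (k⁻¹ * g) * trP (g 1) * (k⁻¹ * g)⁻¹ = trP (k 1) := by
          calc (k⁻¹ * g) * trP (g 1) * (k⁻¹ * g)⁻¹ = k⁻¹ * (g * trP (g 1) * g⁻¹) * k := by group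
            _ = _ := by rw [h3]; group
        obtain ⟨e, he⟩ := key _ (G.mul_mem (G.inv_mem hk) hg) _ _ h4 h2
        rw [← he, trP_comm] at h4
        rw [mul_inv_cancel_right] at h4
        have h5 := trP_inj h4
        have h6 : g = k * trP e := by rw [he]; group
        have h7 : k e = k 1 := by
          rw [← h5, h6]; simp
        have h8 := k.injective h7
        subst h8
        simp [h6]
    have hsurj := Finite.surjective_of_injective hinj
    have hmem : ∀ h ∈ G, h 1 = 1 → ∀ x, x⁻¹ * h x ∈ C := by
      intro h hh h1 x
      let t : Equiv.Perm A := trP x⁻¹ * h * trP x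
      have ht : t ∈ G := G.mul_mem (G.mul_mem (hR _) hh) (hR _)
      have ht1 : t 1 = x⁻¹ * h x := mul_comm (h (1 * x)) x⁻¹ |>.trans (by rw [one_mul])
      obtain ⟨⟨k, hk⟩, hkt⟩ := hsurj ⟨t, ht⟩
      by_cases h2 : k 1 ∈ C
      · simp only [Φ, h2, if_true] at hkt
        have : k = t := congrArg Subtype.val hkt
        rw [← ht1, ← this]
        exact h2
      · exfalso
        simp only [Φ, h2, if_false] at hkt
        have h3 : k * trP (k 1) * k⁻¹ = t := congrArg Subtype.val hkt
        have h4 : ((trP x * k) * trP (k 1) * (trP x * k)⁻¹) = h := by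
          calc (trP x * k) * trP (k 1) * (trP x * k)⁻¹ = trP x * (k * trP (k 1) * k⁻¹) * (trP x)⁻¹ := by group
            _ = h := by rw [h3]; simp only [t, map_inv]; group
        have h5 := conj_fix (k := trP x * k) (b := k 1) (by rw [h4, h1])
        exact h2 (by rw [h5]; exact C.one_mem)
    refine ⟨C, trP (g0 1)⁻¹ * g0, G.mul_mem (hR _) hg0, ?_, tr0 g0, ?_, ?_⟩
    · intro h
      apply hg0'
      rw [map_inv, inv_mul_eq_one] at h
      exact ⟨_, h⟩
    · exact hmem _ (G.mul_mem (hR _) hg0) (tr0 g0)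
    · intro x c hc
      exact congrArg (fun f : Equiv.Perm A => f x) (hC c hc _ (G.mul_mem (hR (g0 1)⁻¹) hg0))

lemma struct_main [Finite A] (S : Set A) (hS : ¬ IsDRR A S) :
    (∃ φ : MulAut A, φ ≠ 1 ∧ ∀ x, x ∈ S ↔ φ x ∈ S) ∨
    ∃ C : Subgroup A, ∃ K : Subgroup (A ⧸ C), K ≠ ⊤ ∧ ∃ d : A ⧸ C → C,
      (∀ q, d q = 1 ↔ q ∈ K) ∧ ∀ x : A, x ∈ S ↔ x * (d (x : A ⧸ C) : A) ∈ S := by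
  classical
  rw [isDRR_iff] at hS
  have hlt : (trP (A := A)).range < cayG S := lt_of_le_not_ge (trP_le S) hS
  obtain ⟨G, hcov, hG⟩ := exists_covBy_le_of_lt hlt
  have hSG : ∀ g ∈ G, ∀ x y : A, x * y⁻¹ ∈ S ↔ g x * (g y)⁻¹ ∈ S := fun g hg => hG hg
  rcases struct_group G hcov with ⟨φ, h1, h2⟩ | ⟨C, h, hh, hne, h1, hc, hm⟩
  · left
    refine ⟨φ, h1, fun x => ?_⟩
    have : x * 1⁻¹ ∈ S ↔ φ x * (φ 1)⁻¹ ∈ S := hSG _ h2 x 1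
    simpa using this
  · right
    let c : A ⧸ C → C := fun q => Quotient.liftOn' q (fun x => (⟨x⁻¹ * h x, hc x⟩ : C)) (by
      intro x y hxy
      rw [QuotientGroup.leftRel_apply] at hxy
      apply Subtype.ext
      have := hm x _ hxy
      rw [mul_inv_cancel_left] at this
      simp only [this]
      rw [mul_comm x⁻¹ y]
      group
      simp [mul_comm])
    have hcx : ∀ x : A, h x = x * (c (x : A ⧸ C) : A) := by
      intro x
      show h x = x * (x⁻¹ * h x)
      simp
    let K : Subgroup (A ⧸ C) :=
      { carrier := {q | ∀ y, c (q * y) = c y}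
        one_mem' := by intro y; simp
        mul_mem' := by
          intro a b ha hb y
          rw [mul_assoc, ha, hb]
        inv_mem' := by
          intro a ha y
          have := ha (a⁻¹ * y)
          rw [mul_inv_cancel_left] at this
          exact this.symm }
    have hK : ∀ q, q ∉ K → ∃ y, c (q * y) ≠ c y := by
      intro q hq
      by_contra hcon
      push Not at hcon
      exact hq hcon
    choose y hy using hK
    refine ⟨C, K, ?_, fun q => if hq : q ∈ K then 1 else c (q * y q hq) * (c (y q hq))⁻¹, ?_, ?_⟩
    · intro htop
      apply hne
      ext x
      have hx : (x : A ⧸ C) ∈ K := by rw [htop]; trivial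
      have h2 := hx 1
      have h3 : c 1 = 1 := by
        apply Subtype.ext
        show (1 : A)⁻¹ * h 1 = 1
        simp [h1]
      rw [mul_one, h3] at h2
      rw [hcx, h2]
      simp
    · intro q
      by_cases hq : q ∈ K
      · simp [hq]
      · simp only [hq, dif_neg, not_false_iff, iff_false]
        rw [mul_inv_eq_one]
        exact hy q hq
    · intro x
      by_cases hq : (x : A ⧸ C) ∈ K
      · simp [hq]
      · simp only [hq, dif_neg, not_false_iff]
        obtain ⟨z, hz⟩ := QuotientGroup.mk_surjective (y _ hq)
        rw [← hz]
        have h4 := hSG h hh (x * z) z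
        rw [hcx, hcx] at h4
        have h5 : x * z * z⁻¹ = x := by group
        rw [h5] at h4
        rw [h4]
        have h6 : x * z * (c ((x * z : A) : A ⧸ C) : A) * (z * (c (z : A ⧸ C) : A))⁻¹ =
          x * ((c ((x : A ⧸ C) * (z : A ⧸ C)) * (c (z : A ⧸ C))⁻¹ : C) : A) := by
          rw [QuotientGroup.mk_mul]
          push_cast
          rw [mul_inv]
          have aux : ∀ p q : A, x * z * p * (z⁻¹ * q⁻¹) = x * (p * q⁻¹) := by
            intro p q
            rw [mul_assoc x z p, mul_comm z p]
            group
          exact aux _ _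
        rw [h6]

end Structure

section Counting

open Classical in
lemma count_inv {A : Type*} [Fintype A] (f : Equiv.Perm A) :
    ∃ Q : ℕ, 2 * Q ≤ Fintype.card A + (Finset.univ.filter fun x => f x = x).card ∧
      (Finset.univ.filter fun S : Set A => ∀ x, x ∈ S ↔ f x ∈ S).card ≤ 2 ^ Q := by
  let s := Equiv.Perm.SameCycle.setoid f
  have hsame : ∀ x : A, (Quotient.mk s (f x)) = Quotient.mk s x := by
    intro x
    apply Quotient.sound
    show Equiv.Perm.SameCycle f (f x) x
    exact Equiv.Perm.sameCycle_apply_left.2 (Equiv.Perm.SameCycle.refl f x)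
  refine ⟨Fintype.card (Quotient s), ?_, ?_⟩
  · let Fx := {x // f x = x}
    let g : Quotient s ⊕ Quotient s → A ⊕ Fx := fun q => match q with
      | Sum.inl q => Sum.inl q.out
      | Sum.inr q => if h : f q.out = q.out then Sum.inr ⟨q.out, h⟩ else Sum.inl (f q.out)
    have hg : Function.Injective g := by
      rintro (p | p) (q | q) hpq
      · simp only [g, Sum.inl.injEq] at hpq
        have := congrArg (Quotient.mk s) hpq
        rw [Quotient.out_eq, Quotient.out_eq] at this
        rw [this]
      · exfalso
        simp only [g] at hpq
        split_ifs at hpq with h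
        rw [Sum.inl.injEq] at hpq
        have := congrArg (Quotient.mk s) hpq
        rw [hsame, Quotient.out_eq, Quotient.out_eq] at this
        subst this
        exact h hpq.symm
      · exfalso
        simp only [g] at hpq
        split_ifs at hpq with h
        rw [Sum.inl.injEq] at hpq
        have := congrArg (Quotient.mk s) hpq
        rw [hsame, Quotient.out_eq, Quotient.out_eq] at this
        subst this
        exact h hpq
      · simp only [g] at hpq
        split_ifs at hpq with h1 h2 h2
        · simp only [Sum.inr.injEq] at hpq
          have := congrArg (fun z : Fx => Quotient.mk s z.1) hpq
          simp only at this
          rw [Quotient.out_eq, Quotient.out_eq] at this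
          rw [this]
        · simp only [Sum.inl.injEq] at hpq
          have := congrArg (Quotient.mk s) (f.injective hpq)
          rw [Quotient.out_eq, Quotient.out_eq] at this
          rw [this]
    have := Fintype.card_le_of_injective g hg
    rw [Fintype.card_sum, Fintype.card_sum, Fintype.card_subtype] at this
    omega
  · rw [← Fintype.card_set, ← Finset.card_univ]
    refine Finset.card_le_card_of_injOn (fun S => (Quotient.mk s) '' S) (by simp) ?_
    have hcl : ∀ S : Set A, (∀ x, x ∈ S ↔ f x ∈ S) → ∀ x, x ∈ S ↔ Quotient.mk s x ∈ Quotient.mk s '' S := by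
      intro S hS x
      refine ⟨fun h => ⟨x, h, rfl⟩, ?_⟩
      rintro ⟨y, hy, hxy⟩
      have h1 : Equiv.Perm.SameCycle f y x := Quotient.exact hxy
      obtain ⟨i, hi⟩ := Equiv.Perm.SameCycle.exists_nat_pow_eq h1
      rw [← hi]
      clear hi h1 hxy
      induction i with
      | zero => simpa using hy
      | succ k ih =>
        rw [pow_succ']
        exact (hS _).1 ih
    intro S hS T hT hST
    simp only [Finset.coe_filter, Finset.mem_univ, true_and, Set.mem_ofPred_eq] at hS hT
    ext x
    rw [hcl S hS, hcl T hT]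
    simp only at hST
    rw [hST]

lemma two_card_le {H : Type*} [Group H] [Finite H] (K : Subgroup H) (hK : K ≠ ⊤) :
    2 * Nat.card K ≤ Nat.card H := by
  rw [← K.card_mul_index, mul_comm]
  apply Nat.mul_le_mul_left
  have h1 : K.index ≠ 1 := fun h => hK (Subgroup.index_eq_one.1 h)
  have h2 : K.index ≠ 0 := Subgroup.index_ne_zero_of_finite
  omega

lemma gens {H : Type*} [Group H] [Finite H] (l : ℕ) (hl : Nat.card H < 2 ^ (l + 1)) :
    ∃ v : Fin l → H, Subgroup.closure (Set.range v) = ⊤ := by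
  have key : ∀ k, ∃ v : Fin k → H, Subgroup.closure (Set.range v) = ⊤ ∨
      2 ^ k ≤ Nat.card (Subgroup.closure (Set.range v)) := by
    intro k
    induction k with
    | zero => exact ⟨Fin.elim0, Or.inr (by simp)⟩
    | succ k ih =>
      obtain ⟨v, hv⟩ := ih
      by_cases htop : Subgroup.closure (Set.range v) = ⊤
      · refine ⟨Fin.cons 1 v, Or.inl ?_⟩
        rw [Fin.range_cons, eq_top_iff, ← htop]
        exact Subgroup.closure_mono (Set.subset_insert _ _)
      · have hv := hv.resolve_left htop
        obtain ⟨x, hx⟩ : ∃ x, x ∉ Subgroup.closure (Set.range v) := by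
          by_contra hcon
          push Not at hcon
          exact htop (eq_top_iff.2 fun x _ => hcon x)
        refine ⟨Fin.cons x v, Or.inr ?_⟩
        rw [Fin.range_cons]
        set K := Subgroup.closure (Set.range v)
        set K' := Subgroup.closure (insert x (Set.range v))
        have hKK : K ≤ K' := Subgroup.closure_mono (Set.subset_insert _ _)
        have hx' : x ∈ K' := Subgroup.subset_closure (Set.mem_insert _ _)
        have h2 := two_card_le (K.subgroupOf K') (by
          intro h
          rw [Subgroup.subgroupOf_eq_top] at h
          exact hx (h hx'))
        rw [Nat.card_congr (Subgroup.subgroupOfEquivOfLe hKK).toEquiv] at h2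
        rw [pow_succ]
        omega
  obtain ⟨v, hv⟩ := key l
  refine ⟨v, ?_⟩
  by_contra htop
  have h1 := hv.resolve_left htop
  have h2 := two_card_le _ htop
  rw [pow_succ] at hl
  omega

lemma card_subgroup_le {B : Type*} [Group B] [Finite B] (l n : ℕ) (hn : Nat.card B ≤ n)
    (hl : n < 2 ^ (l + 1)) : Nat.card (Subgroup B) ≤ n ^ l := by
  have hs : Function.Surjective (fun v : Fin l → B => Subgroup.closure (Set.range v)) := by
    intro H
    obtain ⟨v, hv⟩ := gens (H := H) l (lt_of_le_of_lt ((Subgroup.card_le_card_group H).trans hn) hl)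
    refine ⟨fun i => (v i : B), ?_⟩
    have := congrArg (Subgroup.map H.subtype) hv
    rw [MonoidHom.map_closure, ← Set.range_comp, ← MonoidHom.range_eq_map, Subgroup.range_subtype] at this
    exact this
  refine (Nat.card_le_card_of_surjective _ hs).trans ?_
  rw [Nat.card_fun, Nat.card_fin]
  exact Nat.pow_le_pow_left hn l

lemma card_mulAut_le {B : Type*} [Group B] [Finite B] (l n : ℕ) (hn : Nat.card B ≤ n)
    (hl : n < 2 ^ (l + 1)) : Nat.card (MulAut B) ≤ n ^ l := by
  obtain ⟨v, hv⟩ := gens (H := B) l (lt_of_le_of_lt hn hl)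
  have hi : Function.Injective (fun φ : MulAut B => (fun i => φ (v i))) := by
    intro φ ψ h
    have : φ.toMonoidHom = ψ.toMonoidHom := by
      apply MonoidHom.eq_of_eqOn_dense hv
      rintro _ ⟨i, rfl⟩
      exact congrFun h i
    ext x
    exact DFunLike.congr_fun this x
  refine (Nat.card_le_card_of_injective _ hi).trans ?_
  rw [Nat.card_fun, Nat.card_fin]
  exact Nat.pow_le_pow_left hn l

lemma pow5 (m : ℕ) : (m - 1) ^ 5 ≤ 4 ^ m := by
  rcases lt_or_ge m 8 with h | h
  · interval_cases m <;> norm_num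
  · obtain ⟨k, rfl⟩ := Nat.exists_eq_add_of_le h
    induction k with
    | zero => norm_num
    | succ k ih =>
      have := ih (by omega)
      have e1 : 8 + (k + 1) - 1 = k + 8 := by omega
      have e2 : 8 + k - 1 = k + 7 := by omega
      rw [e1]
      rw [e2] at this
      have e3 : 4 ^ (8 + (k + 1)) = 4 * 4 ^ (8 + k) := by ring
      rw [e3]
      have : (k + 8) ^ 5 ≤ 4 * (k + 7) ^ 5 := by
        have h8 : (7 * (k + 8)) ^ 5 ≤ (8 * (k + 7)) ^ 5 := Nat.pow_le_pow_left (by omega) 5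
        rw [mul_pow, mul_pow] at h8
        norm_num at h8
        omega
      omega

lemma root20 (t n : ℕ) (h : t ^ 20 ≤ 2 ^ (19 * n)) : t ≤ 2 ^ (19 * n / 20 + 1) := by
  refine le_of_lt (lt_of_pow_lt_pow_left₀ 20 (by positivity) (lt_of_le_of_lt h ?_))
  rw [← pow_mul]
  exact Nat.pow_lt_pow_right (by norm_num) (by omega)

open Classical in
lemma count_aut {A : Type*} [CommGroup A] [Fintype A] (φ : MulAut A) (hφ : φ ≠ 1) :
    (Finset.univ.filter fun S : Set A => ∀ x, x ∈ S ↔ φ x ∈ S).card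
      ≤ 2 ^ (19 * Fintype.card A / 20 + 1) := by
  obtain ⟨Q, hQ, h⟩ := count_inv (MulAut.toPerm A φ)
  refine h.trans (Nat.pow_le_pow_right (by norm_num) ?_)
  let F : Subgroup A := (φ.toMonoidHom).eqLocus (MonoidHom.id A)
  have h1 := two_card_le F (by
    intro htop
    apply hφ
    ext x
    have : x ∈ F := by rw [htop]; trivial
    exact this)
  have h2 : Nat.card F = (Finset.univ.filter fun x => (MulAut.toPerm A φ) x = x).card := by
    rw [← Fintype.card_subtype, ← Nat.card_eq_fintype_card]
    rfl
  rw [h2, Nat.card_eq_fintype_card] at h1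
  omega

open Classical in
/-- The family of twisting functions for a pair. -/
noncomputable def dFam {A : Type*} [CommGroup A] [Fintype A] (C : Subgroup A) (K : Subgroup (A ⧸ C)) :
    Finset (A ⧸ C → C) :=
  Fintype.piFinset (fun q => if q ∈ K then {1} else Finset.univ.erase 1)

/-- The twisted translation. -/
noncomputable def twist {A : Type*} [CommGroup A] (C : Subgroup A) (d : A ⧸ C → C) : Equiv.Perm A where
  toFun x := x * (d (x : A ⧸ C) : A)
  invFun x := x * (d (x : A ⧸ C) : A)⁻¹
  left_inv x := by
    have : ((x * (d (x : A ⧸ C) : A) : A) : A ⧸ C) = (x : A ⧸ C) := by simp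
    simp [this]
  right_inv x := by
    have : ((x * (d (x : A ⧸ C) : A)⁻¹ : A) : A ⧸ C) = (x : A ⧸ C) := by simp
    simp [this]

open Classical in
lemma count_twist {A : Type*} [CommGroup A] [Fintype A] (C : Subgroup A) (K : Subgroup (A ⧸ C))
    (hK : K ≠ ⊤) :
    ∑ d ∈ dFam C K, (Finset.univ.filter fun S : Set A => ∀ x, x ∈ S ↔ twist C d x ∈ S).card
      ≤ 2 ^ (19 * Fintype.card A / 20 + 1) := by
  set n := Fintype.card A with hn
  set m := Fintype.card C with hm
  set k := Fintype.card K with hk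
  set b := Fintype.card (A ⧸ C) with hb
  have hn' : n = b * m := by
    have := Subgroup.card_eq_card_quotient_mul_card_subgroup C
    simpa only [Nat.card_eq_fintype_card] using this
  have hkb : 2 * k ≤ b := by
    have := two_card_le K hK
    simpa only [Nat.card_eq_fintype_card] using this
  have hcard : (dFam C K).card = (m - 1) ^ (b - k) := by
    rw [dFam, Fintype.card_piFinset]
    have : ∀ q : A ⧸ C, (if q ∈ K then ({1} : Finset C) else Finset.univ.erase 1).card
      = if q ∈ K then 1 else m - 1 := by
      intro q
      split_ifs
      · simp
      · rw [Finset.card_erase_of_mem (Finset.mem_univ _), Finset.card_univ]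
    simp only [this]
    rw [Finset.prod_ite]
    simp only [Finset.prod_const_one, one_mul, Finset.prod_const]
    congr 1
    have h1 := Finset.card_filter_add_card_filter_not (s := (Finset.univ : Finset (A ⧸ C))) (fun q => q ∈ K)
    have h2 : (Finset.univ.filter fun q : A ⧸ C => q ∈ K).card = k := by
      rw [← Fintype.card_subtype]
    rw [h2, Finset.card_univ] at h1
    omega
  have hfix : ∀ d ∈ dFam C K, (Finset.univ.filter fun x => twist C d x = x).card = k * m := by
    intro d hd
    rw [dFam, Fintype.mem_piFinset] at hd
    have : ∀ x, twist C d x = x ↔ x ∈ K.comap (QuotientGroup.mk' C) := by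
      intro x
      have h1 : twist C d x = x ↔ d (x : A ⧸ C) = 1 := by
        show x * (d (x : A ⧸ C) : A) = x ↔ _
        simp
      rw [h1, Subgroup.mem_comap]
      have := hd (x : A ⧸ C)
      by_cases hx : (x : A ⧸ C) ∈ K
      · simp only [hx, if_true, Finset.mem_singleton] at this
        simp [hx, this]
      · simp only [hx, if_false, Finset.mem_erase] at this
        simp [hx, this]
    simp only [this]
    rw [← Fintype.card_subtype]
    have h3 := Subgroup.index_comap_of_surjective K (QuotientGroup.mk'_surjective C)
    have h4 := (K.comap (QuotientGroup.mk' C)).card_mul_index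
    rw [h3] at h4
    have h5 := K.card_mul_index
    have h6 : K.index ≠ 0 := Subgroup.index_ne_zero_of_finite
    simp only [Nat.card_eq_fintype_card] at h4 h5
    apply Nat.eq_of_mul_eq_mul_right (Nat.pos_of_ne_zero h6)
    refine h4.trans ?_
    rw [← hn, hn', hb, ← h5, ← hk]
    ring
  have hone : ∀ d ∈ dFam C K,
      (Finset.univ.filter fun S : Set A => ∀ x, x ∈ S ↔ twist C d x ∈ S).card ≤ 2 ^ ((n + k * m) / 2) := by
    intro d hd
    obtain ⟨Q, hQ, h⟩ := count_inv (twist C d)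
    rw [hfix d hd] at hQ
    exact h.trans (Nat.pow_le_pow_right (by norm_num) (by omega))
  refine (Finset.sum_le_card_nsmul _ _ _ hone).trans ?_
  rw [hcard, smul_eq_mul]
  apply root20
  obtain ⟨j, hj⟩ : ∃ j, b = k + j := ⟨b - k, by omega⟩
  have e : b - k = j := by omega
  rw [e, mul_pow]
  have h1 : ((m - 1) ^ j) ^ 20 ≤ 2 ^ (8 * (j * m)) := by
    calc ((m - 1) ^ j) ^ 20 = ((m - 1) ^ 5) ^ (4 * j) := by rw [← pow_mul, ← pow_mul]; congr 1; ring
      _ ≤ (4 ^ m) ^ (4 * j) := Nat.pow_le_pow_left (pow5 m) _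
      _ = (2 ^ 2) ^ (m * (4 * j)) := by rw [← pow_mul]; norm_num
      _ = 2 ^ (8 * (j * m)) := by rw [← pow_mul]; congr 1; ring
  have h2 : (2 ^ ((n + k * m) / 2)) ^ 20 ≤ 2 ^ (10 * (n + k * m)) := by
    rw [← pow_mul]
    exact Nat.pow_le_pow_right (by norm_num) (by omega)
  refine (Nat.mul_le_mul h1 h2).trans ?_
  rw [← pow_add]
  apply Nat.pow_le_pow_right (by norm_num)
  have h3 : k * m ≤ j * m := Nat.mul_le_mul_right _ (by omega)
  rw [hj, add_mul] at hn'
  omega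

open Classical in
lemma bad_le {A : Type*} [CommGroup A] [Fintype A] (l : ℕ) (hl : Fintype.card A < 2 ^ (l + 1)) :
    (Finset.univ.filter fun S : Set A => ¬ IsDRR A S).card ≤
      2 * ((Fintype.card A) ^ l) ^ 2 * 2 ^ (19 * Fintype.card A / 20 + 1) := by
  set n := Fintype.card A with hn
  set M := 2 ^ (19 * n / 20 + 1) with hM
  let B1 : Finset (Set A) := (Finset.univ.filter fun φ : MulAut A => φ ≠ 1).biUnion fun φ =>
    Finset.univ.filter fun S : Set A => ∀ x, x ∈ S ↔ φ x ∈ S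
  let B2 : Finset (Set A) := Finset.univ.biUnion fun C : Subgroup A =>
    (Finset.univ.filter fun K : Subgroup (A ⧸ C) => K ≠ ⊤).biUnion fun K =>
      (dFam C K).biUnion fun d =>
        Finset.univ.filter fun S : Set A => ∀ x, x ∈ S ↔ twist C d x ∈ S
  have hsub : (Finset.univ.filter fun S : Set A => ¬ IsDRR A S) ⊆ B1 ∪ B2 := by
    intro S hS
    rw [Finset.mem_filter] at hS
    rw [Finset.mem_union]
    rcases struct_main S hS.2 with ⟨φ, h1, h2⟩ | ⟨C, K, hK, d, hd, h⟩
    · left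
      simp only [B1, Finset.mem_biUnion, Finset.mem_filter, Finset.mem_univ, true_and]
      exact ⟨φ, h1, h2⟩
    · right
      simp only [B2, Finset.mem_biUnion, Finset.mem_filter, Finset.mem_univ, true_and]
      refine ⟨C, K, hK, d, ?_, h⟩
      rw [dFam, Fintype.mem_piFinset]
      intro q
      have := hd q
      by_cases hq : q ∈ K
      · simp [hq, this.2 hq]
      · simp only [hq, if_false, Finset.mem_erase, Finset.mem_univ, and_true]
        exact fun h => hq (this.1 h)
  have hA : Nat.card A ≤ n := by rw [Nat.card_eq_fintype_card]
  have c1 : B1.card ≤ n ^ l * M := by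
    refine (Finset.card_biUnion_le_card_mul _ _ M ?_).trans ?_
    · intro φ hφ
      exact count_aut φ (Finset.mem_filter.1 hφ).2
    · apply Nat.mul_le_mul_right
      refine (Finset.card_le_univ _).trans ?_
      rw [← Nat.card_eq_fintype_card]
      exact card_mulAut_le l n hA hl
  have c2 : B2.card ≤ n ^ l * (n ^ l * M) := by
    refine (Finset.card_biUnion_le_card_mul _ _ (n ^ l * M) ?_).trans ?_
    · intro C _
      refine (Finset.card_biUnion_le_card_mul _ _ M ?_).trans ?_
      · intro K hK
        exact Finset.card_biUnion_le.trans (count_twist C K (Finset.mem_filter.1 hK).2)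
      · apply Nat.mul_le_mul_right
        refine (Finset.card_le_univ _).trans ?_
        rw [← Nat.card_eq_fintype_card]
        exact card_subgroup_le l n ((Nat.card_le_card_of_surjective _ (QuotientGroup.mk'_surjective C)).trans hA) hl
    · apply Nat.mul_le_mul_right
      rw [Finset.card_univ, ← Nat.card_eq_fintype_card]
      exact card_subgroup_le l n hA hl
  refine (Finset.card_le_card hsub).trans ((Finset.card_union_le _ _).trans ?_)
  have hp : 1 ≤ n ^ l := Nat.one_le_pow _ _ (Fintype.card_pos)
  have : n ^ l * M ≤ n ^ l * (n ^ l * M) := Nat.mul_le_mul_left _ (Nat.le_mul_of_pos_left _ hp)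
  calc _ ≤ n ^ l * (n ^ l * M) + n ^ l * (n ^ l * M) := by omega
    _ = _ := by ring

lemma growth (l k : ℕ) (h : k + 20 ≤ l) : 20 * (k + 3 + 2 * (l * (l + 1))) ≤ 2 ^ l := by
  have key : ∀ j : ℕ, 20 * ((j + 20) + 3 + 2 * ((j + 20) * (j + 20 + 1))) ≤ 2 ^ (j + 20) := by
    intro j
    induction j with
    | zero => norm_num
    | succ j ih =>
      have : 2 ^ (j + 1 + 20) = 2 * 2 ^ (j + 20) := by ring
      rw [this]
      nlinarith
  obtain ⟨j, rfl⟩ := Nat.exists_eq_add_of_le (show 20 ≤ l by omega)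
  have := key j
  rw [add_comm j 20] at this
  refine le_trans ?_ this
  apply Nat.mul_le_mul_left
  omega

lemma bad_le' {A : Type*} [CommGroup A] [Fintype A] (k : ℕ) (hk : 2 ^ (k + 20) ≤ Fintype.card A) :
    2 ^ k * Nat.card {S : Set A // ¬ IsDRR A S} ≤ 2 ^ Fintype.card A := by
  classical
  set n := Fintype.card A with hn
  have hn0 : n ≠ 0 := by
    have : 0 < 2 ^ (k + 20) := by positivity
    omega
  set l := Nat.log 2 n with hl
  have h1 : n < 2 ^ (l + 1) := Nat.lt_pow_succ_log_self (by norm_num) n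
  have h2 : 2 ^ l ≤ n := Nat.pow_log_le_self 2 hn0
  have h3 : k + 20 ≤ l := Nat.le_log_of_pow_le (by norm_num) hk
  have h4 := growth l k h3
  have h5 := bad_le (A := A) l h1
  rw [Nat.card_eq_fintype_card, Fintype.card_subtype]
  refine (Nat.mul_le_mul_left _ h5).trans ?_
  have h6 : (n ^ l) ^ 2 ≤ 2 ^ (2 * (l * (l + 1))) := by
    calc (n ^ l) ^ 2 ≤ ((2 ^ (l + 1)) ^ l) ^ 2 := by gcongr
      _ = _ := by rw [← pow_mul, ← pow_mul]; congr 1; ring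
  rw [← hn]
  calc 2 ^ k * (2 * (n ^ l) ^ 2 * 2 ^ (19 * n / 20 + 1))
      ≤ 2 ^ k * (2 * 2 ^ (2 * (l * (l + 1))) * 2 ^ (19 * n / 20 + 1)) := by gcongr
    _ = 2 ^ (k + 1 + 2 * (l * (l + 1)) + (19 * n / 20 + 1)) := by ring
    _ ≤ 2 ^ n := Nat.pow_le_pow_right (by norm_num) (by omega)

end Counting

theorem almost_all_cayley_digraphs_on_abelian_groups_are_DRRs :
    ∀ ε : ℝ, 0 < ε → ∃ N : ℕ, ∀ (A : Type) [Fintype A] [CommGroup A],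
      N ≤ Fintype.card A →
      ((1 - ε) * 2 ^ Fintype.card A : ℝ) ≤ (Nat.card {S : Set A // IsDRR A S} : ℝ) := by
  intro ε hε
  obtain ⟨k, hk⟩ := exists_pow_lt_of_lt_one hε (show (1 / 2 : ℝ) < 1 by norm_num)
  refine ⟨2 ^ (k + 20), ?_⟩
  intro A _ _ hA
  classical
  have h1 := bad_le' (A := A) k hA
  have h2 : Nat.card {S : Set A // IsDRR A S} + Nat.card {S : Set A // ¬ IsDRR A S}
      = 2 ^ Fintype.card A := by
    rw [← Fintype.card_set, Nat.card_eq_fintype_card, Nat.card_eq_fintype_card,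
      Fintype.card_subtype_compl]
    have := Fintype.card_subtype_le (fun S : Set A => IsDRR A S)
    omega
  have h1' : (2 : ℝ) ^ k * (Nat.card {S : Set A // ¬ IsDRR A S} : ℝ) ≤ 2 ^ Fintype.card A := by
    exact_mod_cast h1
  have h2' : (Nat.card {S : Set A // IsDRR A S} : ℝ) + (Nat.card {S : Set A // ¬ IsDRR A S} : ℝ)
      = 2 ^ Fintype.card A := by
    exact_mod_cast h2
  have h3 : (Nat.card {S : Set A // ¬ IsDRR A S} : ℝ) ≤ ε * 2 ^ Fintype.card A := by
    have e : (1 / 2 : ℝ) ^ k * 2 ^ k = 1 := by rw [← mul_pow]; norm_num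
    calc (Nat.card {S : Set A // ¬ IsDRR A S} : ℝ)
        = (1 / 2 : ℝ) ^ k * (2 ^ k * (Nat.card {S : Set A // ¬ IsDRR A S} : ℝ)) := by
          rw [← mul_assoc, e, one_mul]
      _ ≤ (1 / 2 : ℝ) ^ k * 2 ^ Fintype.card A := by gcongr
      _ ≤ ε * 2 ^ Fintype.card A := by gcongr
  linarith
end

section
/- Let A be an abelian group of order n. Then the number of subsets S of A such that Cay(A,S) is not a DRR is at most 2^{3n/4 + 2(log₂ n)² + 1}. -/
theorem exists_gens_list {A : Type} [Fintype A] [CommGroup A] : ∀ (m : ℕ) (H : Subgroup A), Nat.card H < 2 ^ (m+1) →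
    ∃ g : Fin m → A, Subgroup.closure (Set.range g) = H := by
  suffices h : ∀ (m : ℕ) (H : Subgroup A), ∀ (k : ℕ) (K : Subgroup A), K ≤ H → Nat.card H < 2 ^ (m+1) * Nat.card K →
      ∃ g : Fin m → A, K ⊔ Subgroup.closure (Set.range g) = H by
    intro m H hH
    simpa using h m H 0 ⊥ bot_le (by simpa using hH)
  intro m H k
  induction m with
  | zero =>
    intro K hK hc
    refine ⟨Fin.elim0, ?_⟩
    have h1 : K = H := by
      obtain ⟨d, hd⟩ := Subgroup.card_dvd_of_le hK
      have hKp : 0 < Nat.card K := Nat.card_pos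
      have hHp : 0 < Nat.card H := Nat.card_pos
      apply Subgroup.eq_of_le_of_card_ge hK
      rw [hd] at hc hHp ⊢
      have : d < 2 := by
        norm_num at hc
        nlinarith
      nlinarith
    simp [h1]
  | succ m ih =>
    intro K hK hc
    by_cases h : K = H
    · refine ⟨fun _ => 1, ?_⟩
      subst h
      simp
    · obtain ⟨x, hxH, hxK⟩ := SetLike.exists_of_lt (lt_of_le_of_ne hK h)
      have hle : K ⊔ Subgroup.closure {x} ≤ H := sup_le hK (by simpa using hxH)
      obtain ⟨g, hg⟩ := ih (K ⊔ Subgroup.closure {x}) hle (by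
        have hlt : K < K ⊔ Subgroup.closure {x} := by
          refine lt_of_le_of_ne le_sup_left ?_
          intro he
          apply hxK
          rw [he]
          exact (le_sup_right : Subgroup.closure {x} ≤ K ⊔ _) (Subgroup.subset_closure rfl)
        obtain ⟨d, hd⟩ := Subgroup.card_dvd_of_le hlt.le
        have hKp : 0 < Nat.card K := Nat.card_pos
        have h2 : 2 ≤ d := by
          by_contra hcon
          apply hlt.ne
          apply Subgroup.eq_of_le_of_card_ge hlt.le
          rw [hd]
          have : d ≤ 1 := by omega
          nlinarith
        rw [hd]
        have : 2 * Nat.card K ≤ Nat.card K * d := by nlinarith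
        calc _ < _ := hc
          _ = 2 ^ (m+1) * (2 * Nat.card K) := by ring
          _ ≤ _ := Nat.mul_le_mul_left _ this)
      refine ⟨Fin.cons x g, ?_⟩
      rw [← hg, Fin.range_cons, Set.insert_eq, Subgroup.closure_union, sup_assoc]

theorem exists_gens {A : Type} [Fintype A] [CommGroup A] (H : Subgroup A) :
    ∃ g : Fin (Nat.log 2 (Fintype.card A)) → A, Subgroup.closure (Set.range g) = H := by
  apply exists_gens_list
  refine lt_of_le_of_lt (Subgroup.card_le_card_group H) ?_
  rw [Nat.card_eq_fintype_card]
  exact Nat.lt_pow_succ_log_self (by norm_num) _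

theorem card_subgroup_le_s1 (A : Type) [Fintype A] [CommGroup A] :
    Nat.card (Subgroup A) ≤ Fintype.card A ^ (Nat.log 2 (Fintype.card A)) := by
  have := Nat.card_le_card_of_surjective
    (fun g : Fin (Nat.log 2 (Fintype.card A)) → A => Subgroup.closure (Set.range g)) exists_gens
  simpa using this

theorem card_aut_le (A : Type) [Fintype A] [CommGroup A] :
    Nat.card (A ≃* A) ≤ Fintype.card A ^ (Nat.log 2 (Fintype.card A)) := by
  obtain ⟨g, hg⟩ := exists_gens (⊤ : Subgroup A)
  have := Nat.card_le_card_of_injective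
    (fun (φ : A ≃* A) => (fun i => φ (g i) : Fin (Nat.log 2 (Fintype.card A)) → A)) (by
      intro φ ψ h
      have : φ.toMonoidHom = ψ.toMonoidHom := by
        apply MonoidHom.eq_of_eqOn_dense hg
        rintro _ ⟨i, rfl⟩
        exact congrFun h i
      ext x
      exact DFunLike.congr_fun this x)
  simpa using this

theorem card_invariant_le {A : Type} [Fintype A] (f : A → A)
    (hf : 2 * Nat.card {x // f x = x} ≤ Fintype.card A) :
    (Nat.card {S : Set A // ∀ x, x ∈ S ↔ f x ∈ S} : ℝ) ≤ 2 ^ (3 * Fintype.card A / 4 : ℝ) := by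
  classical
  let r : Setoid A := Relation.EqvGen.setoid (fun x y => y = f x)
  let Q := Quotient r
  have hr : ∀ x, r x (f x) := fun x => Relation.EqvGen.rel _ _ rfl
  have h1 : Nat.card {S : Set A // ∀ x, x ∈ S ↔ f x ∈ S} ≤ 2 ^ Nat.card Q := by
    have := Nat.card_le_card_of_injective
      (fun (S : {S : Set A // ∀ x, x ∈ S ↔ f x ∈ S}) => ({q : Q | q.out ∈ S.1} : Set Q)) (by
      rintro ⟨S, hS⟩ ⟨T, hT⟩ h
      have key : ∀ (U : Set A), (∀ x, x ∈ U ↔ f x ∈ U) → ∀ x y, r x y → (x ∈ U ↔ y ∈ U) := by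
        intro U hU x y hxy
        induction hxy with
        | rel x y h => rw [h]; exact hU x
        | refl x => rfl
        | symm x y _ ih => exact ih.symm
        | trans x y z _ _ i1 i2 => exact i1.trans i2
      apply Subtype.ext
      ext x
      have hx : r (Quotient.mk r x).out x := Quotient.mk_out x
      have h2 := Set.ext_iff.1 h (Quotient.mk r x)
      exact (key S hS _ _ hx).symm.trans (h2.trans (key T hT _ _ hx)))
    simpa using this
  have h2 : 2 * Nat.card Q ≤ Fintype.card A + Nat.card {x // f x = x} := by
    have := Nat.card_le_card_of_injective
      (fun (u : Q ⊕ Q) => (match u with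
        | Sum.inl q => Sum.inl q.out
        | Sum.inr q => if h : f q.out = q.out then Sum.inr ⟨q.out, h⟩ else Sum.inl (f q.out) :
          A ⊕ {x // f x = x})) (by
      have h3 : ∀ q : Q, Quotient.mk r (f q.out) = q := by
        intro q
        conv_rhs => rw [← Quotient.out_eq q]
        exact (Quotient.sound (hr _)).symm
      have h4 : ∀ q : Q, Quotient.mk r (q.out) = q := Quotient.out_eq
      rintro (q | q) (q' | q') h
      · have := Sum.inl.inj h
        rw [← h4 q, this, h4]
      · dsimp only at h
        split_ifs at h with hh
        have h := Sum.inl.inj h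
        have : q = q' := by rw [← h4 q, h, h3]
        subst this
        exact absurd h.symm hh
      · dsimp only at h
        split_ifs at h with hh
        have h := Sum.inl.inj h
        have : q = q' := by rw [← h4 q', ← h, h3]
        subst this
        exact absurd h hh
      · dsimp only at h
        split_ifs at h with hh hh' hh'
        · have := congrArg Subtype.val (Sum.inr.inj h)
          dsimp only at this
          rw [← h4 q, this, h4]
        · have h := Sum.inl.inj h
          rw [← h3 q, h, h3])
    rw [Nat.card_sum, Nat.card_sum, Nat.card_eq_fintype_card (α := A)] at this
    omega
  have h3 : (Nat.card Q : ℝ) ≤ 3 * Fintype.card A / 4 := by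
    have : 4 * Nat.card Q ≤ 3 * Fintype.card A := by omega
    have : (4 * Nat.card Q : ℝ) ≤ 3 * Fintype.card A := by exact_mod_cast this
    linarith
  calc (Nat.card {S : Set A // ∀ x, x ∈ S ↔ f x ∈ S} : ℝ) ≤ ((2 ^ Nat.card Q : ℕ) : ℝ) := by exact_mod_cast h1
    _ = (2:ℝ) ^ (Nat.card Q : ℝ) := by rw [Real.rpow_natCast]; push_cast; rfl
    _ ≤ _ := Real.rpow_le_rpow_of_exponent_le (by norm_num) h3

theorem two_mul_card_le {A : Type} [Fintype A] [CommGroup A] (Z : Subgroup A) (hZ : Z ≠ ⊤) :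
    2 * Nat.card Z ≤ Fintype.card A := by
  rw [← Nat.card_eq_fintype_card, ← Subgroup.card_mul_index Z]
  have : 1 < Z.index := Subgroup.one_lt_index_of_ne_top hZ
  nlinarith

/-- the shift outside a subgroup -/
noncomputable def wreathShift {A : Type} [CommGroup A] (p : Subgroup A × A) (x : A) : A :=
  open Classical in if x ∈ p.1 then x else x * p.2

theorem count_of_structure (A : Type) [Fintype A] [CommGroup A] (P : Set A → Prop)
    (hP : ∀ S, P S → (∃ φ : A ≃* A, φ ≠ 1 ∧ ∀ s, s ∈ S ↔ φ s ∈ S) ∨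
      ∃ (Z : Subgroup A) (h : A), Z ≠ ⊤ ∧ h ≠ 1 ∧ ∀ s, s ∉ Z → (s ∈ S ↔ s * h ∈ S)) :
    (Nat.card {S : Set A // P S} : ℝ) ≤
      2 ^ ((3 * (Fintype.card A : ℕ) / 4 : ℝ) + 2 * (Real.logb 2 (Fintype.card A : ℕ)) ^ 2 + 1) := by
  classical
  let I := {φ : A ≃* A // φ ≠ 1} ⊕ {p : Subgroup A × A // p.1 ≠ ⊤ ∧ p.2 ≠ 1}
  let F : I → A → A := fun i => match i with
    | Sum.inl φ => φ.1
    | Sum.inr p => wreathShift p.1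
  have hF : ∀ i, 2 * Nat.card {x // F i x = x} ≤ Fintype.card A := by
    rintro (⟨φ, hφ⟩ | ⟨⟨Z, h⟩, hZ, hh⟩)
    · let K : Subgroup A := MonoidHom.eqLocus φ.toMonoidHom (MonoidHom.id A)
      refine two_mul_card_le K ?_
      intro hK
      apply hφ
      ext x
      have : x ∈ K := by rw [hK]; trivial
      exact this
    · refine le_trans (Nat.mul_le_mul_left 2 ?_) (two_mul_card_le Z hZ)
      refine Nat.card_le_card_of_injective (fun x => (⟨x.1, ?_⟩ : Z)) ?_
      · obtain ⟨x, hx⟩ := x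
        by_contra hc
        apply hh
        have : x * h = x := by simpa [F, wreathShift, hc] using hx
        simpa using this
      · intro x y hxy
        exact Subtype.ext (congrArg (fun z : Z => (z : A)) hxy)
  have hex : ∀ S : {S : Set A // P S}, ∃ i, ∀ x, x ∈ S.1 ↔ F i x ∈ S.1 := by
    rintro ⟨S, hS⟩
    rcases hP S hS with ⟨φ, hφ, h⟩ | ⟨Z, h, hZ, hh, hs⟩
    · exact ⟨Sum.inl ⟨φ, hφ⟩, h⟩
    · refine ⟨Sum.inr ⟨(Z, h), hZ, hh⟩, fun x => ?_⟩
      by_cases hx : x ∈ Z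
      · simp [F, wreathShift, hx]
      · simpa [F, wreathShift, hx] using hs x hx
  choose i hi using hex
  have : Finite I := inferInstance
  have : Fintype I := Fintype.ofFinite I
  have h1 := Nat.card_le_card_of_injective
    (fun S => (⟨i S, S.1, hi S⟩ : Σ j : I, {S : Set A // ∀ x, x ∈ S ↔ F j x ∈ S})) (by
      intro S T h
      have := congrArg (fun z : (Σ j : I, {S : Set A // ∀ x, x ∈ S ↔ F j x ∈ S}) => z.2.1) h
      exact Subtype.ext this)
  rw [Nat.card_sigma] at h1
  set n := Fintype.card A with hn
  set m := Nat.log 2 n with hm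
  set L := Real.logb 2 n with hL
  have hnpos : 0 < n := Fintype.card_pos
  have hI : Nat.card I ≤ n ^ m + n ^ (m + 1) := by
    rw [Nat.card_sum]
    refine add_le_add ?_ ?_
    · exact (Nat.card_le_card_of_injective _ Subtype.val_injective).trans (card_aut_le A)
    · refine (Nat.card_le_card_of_injective _ Subtype.val_injective).trans ?_
      rw [Nat.card_prod, pow_succ, Nat.card_eq_fintype_card (α := A)]
      exact Nat.mul_le_mul_right _ (card_subgroup_le_s1 A)
  have hLn : (n : ℝ) = 2 ^ L := by
    rw [hL, Real.rpow_logb] <;> norm_num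
    exact hnpos
  have hmL : (m : ℝ) ≤ L := by
    have := Nat.pow_log_le_self 2 hnpos.ne'
    have h2 : ((2:ℝ) ^ (m:ℝ)) ≤ n := by rw [Real.rpow_natCast]; exact_mod_cast this
    rw [hL, Real.le_logb_iff_rpow_le (by norm_num) (by exact_mod_cast hnpos)]
    exact h2
  have hL0 : 0 ≤ L := le_trans (Nat.cast_nonneg m) hmL
  have hLL : L ≤ L ^ 2 := by
    rcases Nat.lt_or_ge 1 n with h | h
    · have : 1 ≤ L := by
        rw [hL, Real.le_logb_iff_rpow_le (by norm_num) (by exact_mod_cast hnpos)]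
        simpa using (by exact_mod_cast h : (2:ℝ) ≤ n)
      nlinarith
    · have : n = 1 := by omega
      have : L = 0 := by rw [hL, this]; simp
      rw [this]; norm_num
  have hI2 : (Nat.card I : ℝ) ≤ 2 ^ (2 * L ^ 2 + 1) := by
    have e : ∀ k : ℕ, (k : ℝ) * L ≤ 2 * L ^ 2 → (n : ℝ) ^ k ≤ 2 ^ (2 * L ^ 2) := by
      intro k hk
      rw [hLn, ← Real.rpow_natCast, ← Real.rpow_mul (by norm_num)]
      exact Real.rpow_le_rpow_of_exponent_le (by norm_num) (by linarith)
    have e1 := e m (by nlinarith)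
    have e2 := e (m + 1) (by push_cast; nlinarith)
    rw [Real.rpow_add (by norm_num), Real.rpow_one]
    have : (Nat.card I : ℝ) ≤ (n : ℝ) ^ m + (n : ℝ) ^ (m + 1) := by exact_mod_cast hI
    linarith
  calc (Nat.card {S : Set A // P S} : ℝ)
      ≤ ∑ j : I, (Nat.card {S : Set A // ∀ x, x ∈ S ↔ F j x ∈ S} : ℝ) := by exact_mod_cast h1
    _ ≤ ∑ j : I, (2:ℝ) ^ (3 * n / 4 : ℝ) := Finset.sum_le_sum (fun j _ => card_invariant_le _ (hF j))
    _ = (Nat.card I : ℝ) * (2:ℝ) ^ (3 * n / 4 : ℝ) := by simp [Nat.card_eq_fintype_card]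
    _ ≤ 2 ^ (2 * L ^ 2 + 1) * (2:ℝ) ^ (3 * n / 4 : ℝ) := by gcongr
    _ = _ := by rw [← Real.rpow_add (by norm_num)]; congr 1; ring

open Equiv in
theorem frobenius_core {A : Type} [Fintype A] [CommGroup A] (G : Subgroup (Perm A))
    (hT : ∀ a, Equiv.mulLeft a ∈ G) (hG : ∃ g ∈ G, ∀ a, g ≠ Equiv.mulLeft a)
    (hM : ∀ a b, ∀ w ∈ G, Equiv.mulLeft a * w = w * Equiv.mulLeft b →
      (∃ c, w = Equiv.mulLeft c) ∨ ∀ g ∈ G, Equiv.mulLeft a * g = g * Equiv.mulLeft a)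
    (hZ : ∃ a, ¬ ∀ g ∈ G, Equiv.mulLeft a * g = g * Equiv.mulLeft a) :
    ∃ (Z : Subgroup A) (h : A), Z ≠ ⊤ ∧ h ≠ 1 ∧
      ∀ s, s ∉ Z → ∃ k ∈ G, k s * (k 1)⁻¹ = s * h := by
  classical
  let t : A →* Perm A := MonoidHom.mk' (fun a => Equiv.mulLeft a) (by intro a b; ext x; simp)
  have ht : ∀ a x, t a x = a * x := fun a x => rfl
  have htc : ∀ a b, t a * t b = t b * t a := by
    intro a b; rw [← map_mul, ← map_mul, mul_comm]
  have htG : ∀ a, t a ∈ G := hT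
  change ∀ a b, ∀ w ∈ G, t a * w = w * t b →
      (∃ c, w = t c) ∨ ∀ g ∈ G, t a * g = g * t a at hM
  change ∃ g ∈ G, ∀ a, g ≠ t a at hG
  change ∃ a, ¬ ∀ g ∈ G, t a * g = g * t a at hZ
  let Z : Subgroup A :=
    { carrier := {a | ∀ g ∈ G, t a * g = g * t a}
      one_mem' := by intro g _; simp
      mul_mem' := by
        intro a b ha hb g hg
        rw [map_mul, mul_assoc, hb g hg, ← mul_assoc, ha g hg, mul_assoc]
      inv_mem' := by
        intro a ha g hg
        have := ha g hg
        rw [map_inv, inv_mul_eq_iff_eq_mul, ← mul_assoc, this, mul_inv_cancel_right] }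
  have hZmem : ∀ a, a ∈ Z ↔ ∀ g ∈ G, t a * g = g * t a := fun a => Iff.rfl
  have hZap : ∀ a ∈ Z, ∀ g ∈ G, ∀ x, g (a * x) = a * g x := by
    intro a ha g hg x
    exact (DFunLike.congr_fun ((hZmem a).1 ha g hg) x).symm
  have hM' : ∀ a b, a ∉ Z → ∀ w ∈ G, t a * w = w * t b → ∃ c, w = t c := by
    intro a b ha w hw h
    exact (hM a b w hw h).resolve_right ha
  -- conjugates of noncentral translations avoid `K`
  have hconj : ∀ x ∈ G, x 1 = 1 → ∀ a, a ∉ Z → (x * t a * x⁻¹) 1 ∉ Z := by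
    intro x hx hx1 a ha hz
    have hxi : x⁻¹ 1 = 1 := by rw [Equiv.Perm.inv_eq_iff_eq, hx1]
    set z := (x * t a * x⁻¹) 1 with hzdef
    have h1 : z = x a := by
      rw [hzdef, Perm.mul_apply, Perm.mul_apply, hxi, ht, mul_one]
    have h2 : x (z⁻¹ * a) = 1 := by
      rw [hZap _ (Z.inv_mem hz) x hx, ← h1]; simp
    have h3 : z⁻¹ * a = 1 := x.injective (h2.trans hx1.symm)
    apply ha
    have : a = z := by rw [inv_mul_eq_one] at h3; exact h3.symm
    rw [this]; exact hz
  -- every element outside `K` is a conjugate of a noncentral translation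
  have hsurj : ∀ g ∈ G, g 1 ∉ Z → ∃ x ∈ G, x 1 = 1 ∧ ∃ a, a ∉ Z ∧ g = x * t a * x⁻¹ := by
    let X := {x : Perm A // x ∈ G ∧ x 1 = 1}
    let Y := {a : A // a ∉ Z}
    let Ψ : X × Y → X × Y := fun p =>
      (⟨(t ((p.1.1 * t p.2.1 * p.1.1⁻¹) 1))⁻¹ * (p.1.1 * t p.2.1 * p.1.1⁻¹), by
        refine ⟨G.mul_mem (G.inv_mem (htG _)) (G.mul_mem (G.mul_mem p.1.2.1 (htG _)) (G.inv_mem p.1.2.1)), ?_⟩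
        rw [Perm.mul_apply, Equiv.Perm.inv_eq_iff_eq, ht, mul_one]⟩,
       ⟨(p.1.1 * t p.2.1 * p.1.1⁻¹) 1, hconj _ p.1.2.1 p.1.2.2 _ p.2.2⟩)
    have hinj : Function.Injective Ψ := by
      rintro ⟨⟨x, hx, hx1⟩, ⟨a, ha⟩⟩ ⟨⟨y, hy, hy1⟩, ⟨b, hb⟩⟩ h
      have h2 : (x * t a * x⁻¹) 1 = (y * t b * y⁻¹) 1 :=
        congrArg (fun q : X × Y => q.2.1) h
      have h1 : (t ((x * t a * x⁻¹) 1))⁻¹ * (x * t a * x⁻¹)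
          = (t ((y * t b * y⁻¹) 1))⁻¹ * (y * t b * y⁻¹) :=
        congrArg (fun q : X × Y => q.1.1) h
      rw [h2] at h1
      have h3 : x * t a * x⁻¹ = y * t b * y⁻¹ := mul_left_cancel h1
      have h4 : t a * (x⁻¹ * y) = (x⁻¹ * y) * t b := by
        have : x * (t a * (x⁻¹ * y)) = x * ((x⁻¹ * y) * t b) := by
          calc x * (t a * (x⁻¹ * y)) = (x * t a * x⁻¹) * y := by group
            _ = x * ((x⁻¹ * y) * t b) := by rw [h3]; group
        exact mul_left_cancel this
      obtain ⟨c, hc⟩ := hM' a b ha _ (G.mul_mem (G.inv_mem hx) hy) h4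
      have hc1 : c = 1 := by
        have := DFunLike.congr_fun hc 1
        rw [Perm.mul_apply, hy1, ht, mul_one] at this
        rw [← this, Equiv.Perm.inv_eq_iff_eq, hx1]
      rw [hc1, map_one, inv_mul_eq_one] at hc
      subst hc
      have h5 : t a = t b := by simpa using h3
      have h6 : a = b := by simpa [ht] using DFunLike.congr_fun h5 1
      subst h6
      rfl
    have hs : Function.Surjective Ψ := Finite.injective_iff_surjective.1 hinj
    intro g hg hg1
    obtain ⟨⟨⟨x, hx, hx1⟩, ⟨a, ha⟩⟩, h⟩ := hs
      (⟨(t (g 1))⁻¹ * g, G.mul_mem (G.inv_mem (htG _)) hg, by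
        rw [Perm.mul_apply, Equiv.Perm.inv_eq_iff_eq, ht, mul_one]⟩, ⟨g 1, hg1⟩)
    have h2 : (x * t a * x⁻¹) 1 = g 1 := congrArg (fun q : X × Y => q.2.1) h
    have h1 : (t ((x * t a * x⁻¹) 1))⁻¹ * (x * t a * x⁻¹) = (t (g 1))⁻¹ * g :=
      congrArg (fun q : X × Y => q.1.1) h
    rw [h2] at h1
    exact ⟨x, hx, hx1, a, ha, (mul_left_cancel h1).symm⟩
  -- the subgroup `K`
  have hev : ∀ k ∈ G, ∀ l : Perm A, l 1 ∈ Z → (k * l) 1 = k 1 * l 1 := by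
    intro k hk l hl
    have := hZap _ hl k hk 1
    rw [mul_one] at this
    rw [Perm.mul_apply, this, mul_comm]
  have hevi : ∀ k ∈ G, k 1 ∈ Z → k⁻¹ 1 = (k 1)⁻¹ := by
    intro k hk hk1
    have := hev _ (G.inv_mem hk) k hk1
    rw [inv_mul_cancel, Perm.one_apply] at this
    exact eq_inv_iff_mul_eq_one.2 this.symm
  let K : Subgroup (Perm A) :=
    { carrier := {k | k ∈ G ∧ k 1 ∈ Z}
      one_mem' := ⟨G.one_mem, Z.one_mem⟩
      mul_mem' := by
        rintro k l ⟨hk, hk1⟩ ⟨hl, hl1⟩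
        refine ⟨G.mul_mem hk hl, ?_⟩
        rw [hev k hk l hl1]
        exact Z.mul_mem hk1 hl1
      inv_mem' := by
        rintro k ⟨hk, hk1⟩
        refine ⟨G.inv_mem hk, ?_⟩
        rw [hevi k hk hk1]
        exact Z.inv_mem hk1 }
  have hKmem : ∀ k, k ∈ K ↔ k ∈ G ∧ k 1 ∈ Z := fun k => Iff.rfl
  have hKn : ∀ g ∈ G, ∀ k ∈ K, g * k * g⁻¹ ∈ K := by
    intro g hg k hk
    have hkG : g * k * g⁻¹ ∈ G := G.mul_mem (G.mul_mem hg hk.1) (G.inv_mem hg)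
    refine ⟨hkG, ?_⟩
    by_contra hc
    obtain ⟨x, hx, hx1, a, ha, h⟩ := hsurj _ hkG hc
    set w := g⁻¹ * x with hw
    have hwG : w ∈ G := G.mul_mem (G.inv_mem hg) hx
    have h1 : k = w * t a * w⁻¹ := by
      calc k = g⁻¹ * (g * k * g⁻¹) * g := by group
        _ = _ := by rw [h, hw]; group
    -- write `w = w₁ * t b`
    obtain ⟨b, hb⟩ : ∃ b, w b = 1 := w.surjective 1
    have h2 := hconj (w * t b) (G.mul_mem hwG (htG b)) (by simp [ht, hb]) a ha
    have h3 : w * t b * t a * (w * t b)⁻¹ = k := by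
      rw [h1, mul_assoc w, htc b a]; group
    rw [h3] at h2
    exact h2 hk.2
  -- `K` is abelian
  have hKc : ∀ k ∈ K, ∀ l ∈ K, k * l = l * k := by
    intro k hk l hl
    have e : ∀ k ∈ K, ∀ l ∈ K, (k * l) 1 = (l * k) 1 := by
      intro k hk l hl
      rw [hev k hk.1 l hl.2, hev l hl.1 k hk.2, mul_comm]
    ext x
    have := e _ (hKn _ (htG x⁻¹) k hk) _ (hKn _ (htG x⁻¹) l hl)
    simpa [ht, Perm.mul_apply, ← map_inv] using this
  -- the maps `c a`
  let c : A → Perm A → Perm A := fun a k => t a * k * (t a)⁻¹ * k⁻¹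
  have hcK : ∀ a, ∀ k ∈ K, c a k ∈ K := fun a k hk => K.mul_mem (hKn _ (htG a) k hk) (K.inv_mem hk)
  have hcc : ∀ a b, ∀ k ∈ K, c b (c a k) = c a (c b k) := by
    intro a b k hk
    have n1 := hKn _ (htG a) k hk
    have n2 := hKn _ (htG b) k hk
    have n3 := hKn _ (htG b) _ n1
    have e1 : c b (c a k) = (t b * (t a * k * (t a)⁻¹) * (t b)⁻¹) *
        (t b * k * (t b)⁻¹)⁻¹ * (k * (t a * k * (t a)⁻¹)⁻¹) := by
      simp only [c]; group
    have e2 : c a (c b k) = (t a * (t b * k * (t b)⁻¹) * (t a)⁻¹) *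
        (t a * k * (t a)⁻¹)⁻¹ * (k * (t b * k * (t b)⁻¹)⁻¹) := by
      simp only [c]; group
    have e3 : t a * (t b * k * (t b)⁻¹) * (t a)⁻¹ = t b * (t a * k * (t a)⁻¹) * (t b)⁻¹ := by
      calc _ = (t a * t b) * k * (t a * t b)⁻¹ := by group
        _ = _ := by rw [htc]; group
    rw [e1, e2, e3]
    clear e1 e2 e3
    generalize t b * (t a * k * (t a)⁻¹) * (t b)⁻¹ = X at *
    generalize t a * k * (t a)⁻¹ = P at *
    generalize t b * k * (t b)⁻¹ = Q at *
    rw [mul_assoc X, mul_assoc X]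
    congr 1
    rw [hKc _ (K.inv_mem n2) _ (K.mul_mem hk (K.inv_mem n1)), hKc _ hk _ (K.inv_mem n1), mul_assoc]
  have hcm : ∀ a, ∀ k ∈ K, ∀ l ∈ K, c a (k * l) = c a k * c a l := by
    intro a k hk l hl
    have e : c a (k * l) = (t a * k * (t a)⁻¹) * (c a l * k⁻¹) := by simp only [c]; group
    rw [e, hKc _ (hcK a l hl) _ (K.inv_mem hk)]
    simp only [c, mul_assoc]
  have hct : ∀ a, a ∉ Z → ∀ l ∈ K, (∃ d, c a l = t d) → ∃ e, l = t e := by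
    rintro a ha l hl ⟨d, hd⟩
    have h0 : t a * l = t d * l * t a := by rw [← hd]; simp only [c]; group
    have h1 : t a * l⁻¹ = l⁻¹ * t (d⁻¹ * a) := by
      rw [map_mul, map_inv, eq_inv_mul_iff_mul_eq, eq_inv_mul_iff_mul_eq]
      calc t d * (l * (t a * l⁻¹)) = (t d * l * t a) * l⁻¹ := by group
        _ = t a := by rw [← h0]; group
    obtain ⟨e, he⟩ := hM' a _ ha _ (G.inv_mem hl.1) h1
    exact ⟨e⁻¹, by rw [map_inv, ← he, inv_inv]⟩
  have hker : ∀ a, a ∉ Z → ∀ l ∈ K, (∃ d, c a l = t d) → c a l = 1 := by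
    intro a ha l hl h
    obtain ⟨e, rfl⟩ := hct a ha l hl h
    simp only [c]
    rw [htc a e]; group
  have hindep : ∀ a, a ∉ Z → ∀ b, b ∉ Z → ∀ k ∈ K, ∃ l ∈ K, c a k = c b l := by
    intro a ha b hb k hk
    let R := {r : Perm A // ∃ k ∈ K, r = c a k}
    let f : R → R := fun r => ⟨c b r.1, by
      obtain ⟨k, hk, h⟩ := r.2
      exact ⟨c b k, hcK b k hk, by rw [h, hcc a b k hk]⟩⟩
    have hf : Function.Injective f := by
      rintro ⟨r, k, hk, hr⟩ ⟨r', k', hk', hr'⟩ h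
      have h1 : c b r = c b r' := congrArg Subtype.val h
      have hrK : r ∈ K := hr ▸ hcK a k hk
      have hrK' : r' ∈ K := hr' ▸ hcK a k' hk'
      have h2 := hcm b r hrK (r⁻¹ * r') (K.mul_mem (K.inv_mem hrK) hrK')
      rw [mul_inv_cancel_left, ← h1, left_eq_mul] at h2
      obtain ⟨e, he⟩ := hct b hb _ (K.mul_mem (K.inv_mem hrK) hrK') ⟨1, by rw [h2, map_one]⟩
      have h3 := hcm a k hk (k⁻¹ * k') (K.mul_mem (K.inv_mem hk) hk')
      rw [mul_inv_cancel_left, ← hr, ← hr', ← inv_mul_eq_iff_eq_mul] at h3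
      have h4 := hker a ha _ (K.mul_mem (K.inv_mem hk) hk') ⟨e, by rw [← h3, he]⟩
      rw [h4, inv_mul_eq_one] at h3
      exact Subtype.ext h3
    obtain ⟨⟨r, k', hk', hr⟩, h⟩ := Finite.injective_iff_surjective.1 hf ⟨c a k, k, hk, rfl⟩
    have h1 : c b r = c a k := congrArg Subtype.val h
    exact ⟨r, hr ▸ hcK a k' hk', h1.symm⟩
  obtain ⟨a0, ha0⟩ := hZ
  change a0 ∉ Z at ha0
  have hk0 : ∃ k ∈ K, c a0 k 1 ≠ 1 := by
    by_contra! hcon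
    have h1 : ∀ k ∈ K, c a0 k = 1 := by
      intro k hk
      ext x
      have h2 := hcon _ (hKn _ (htG x⁻¹) k hk)
      have h3 : c a0 (t x⁻¹ * k * (t x⁻¹)⁻¹) = t x⁻¹ * c a0 k * t x := by
        have e : t a0 * (t x)⁻¹ = (t x)⁻¹ * t a0 := by rw [← map_inv, htc]
        have e' : t x * (t a0)⁻¹ = (t a0)⁻¹ * t x := by rw [← map_inv, htc]
        calc c a0 (t x⁻¹ * k * (t x⁻¹)⁻¹)
            = (t a0 * (t x)⁻¹) * k * (t x * (t a0)⁻¹) * ((t x)⁻¹ * k⁻¹ * t x) := by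
              simp only [c, map_inv]; group
          _ = _ := by rw [e, e']; simp only [c, map_inv]; group
      rw [h3, Perm.mul_apply, Perm.mul_apply, ht, ht, mul_one, inv_mul_eq_one] at h2
      rw [Perm.one_apply, ← h2]
    obtain ⟨g, hg, hgt⟩ := hG
    obtain ⟨e, he⟩ := hct a0 ha0 ((t (g 1))⁻¹ * g) ⟨G.mul_mem (G.inv_mem (htG _)) hg, by
      have : ((t (g 1))⁻¹ * g) 1 = 1 := by
        rw [Perm.mul_apply, Equiv.Perm.inv_eq_iff_eq, ht, mul_one]
      rw [this]; exact Z.one_mem⟩ ⟨1, by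
        rw [map_one t]
        apply h1
        refine ⟨G.mul_mem (G.inv_mem (htG _)) hg, ?_⟩
        have : ((t (g 1))⁻¹ * g) 1 = 1 := by
          rw [Perm.mul_apply, Equiv.Perm.inv_eq_iff_eq, ht, mul_one]
        rw [this]; exact Z.one_mem⟩
    rw [inv_mul_eq_iff_eq_mul, ← map_mul] at he
    exact hgt _ he
  obtain ⟨k0, hk0, hne⟩ := hk0
  refine ⟨Z, c a0 k0 1, ?_, hne, ?_⟩
  · intro h
    apply ha0
    rw [h]; trivial
  · intro s hs
    obtain ⟨l, hl, h⟩ := hindep a0 ha0 s⁻¹ (fun h => hs (by simpa using Z.inv_mem h)) k0 hk0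
    refine ⟨l, hl.1, ?_⟩
    have h2 : c s⁻¹ l 1 = s⁻¹ * l (s * (l 1)⁻¹) := by
      simp only [c, map_inv, inv_inv]
      rw [Perm.mul_apply, hevi l hl.1 hl.2, ← map_inv]
      rfl
    rw [h, h2, mul_comm s (l 1)⁻¹, hZap _ (Z.inv_mem hl.2) l hl.1, mul_inv_cancel_left, mul_comm]

open Equiv in
theorem structure_of_not_DRR (A : Type) [Fintype A] [CommGroup A] (S : Set A) (hS : ¬ IsDRR A S) :
    (∃ φ : A ≃* A, φ ≠ 1 ∧ ∀ s, s ∈ S ↔ φ s ∈ S) ∨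
      ∃ (Z : Subgroup A) (h : A), Z ≠ ⊤ ∧ h ≠ 1 ∧ ∀ s, s ∉ Z → (s ∈ S ↔ s * h ∈ S) := by
  classical
  let Γ : Subgroup (Perm A) :=
    { carrier := cayleyAutSet A S
      one_mem' := by intro g h; rfl
      mul_mem' := by
        intro σ τ hσ hτ g h
        exact (hτ g h).trans (hσ _ _)
      inv_mem' := by
        intro σ hσ g h
        have := hσ (σ⁻¹ g) (σ⁻¹ h)
        simpa using this.symm }
  let t : A →* Perm A := MonoidHom.mk' (fun a => Equiv.mulLeft a) (by intro a b; ext x; simp)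
  have ht : ∀ a x, t a x = a * x := fun a x => rfl
  have htc : ∀ a b, t a * t b = t b * t a := by
    intro a b; rw [← map_mul, ← map_mul, mul_comm]
  have hΓ1 : ∀ k ∈ Γ, ∀ s, s ∈ S ↔ k s * (k 1)⁻¹ ∈ S := by
    intro k hk s
    have := hk s 1
    simpa using this
  have hTΓ : t.range ≤ Γ := by
    rintro _ ⟨a, rfl⟩ g h
    rw [ht, ht, mul_inv, mul_mul_mul_comm, mul_inv_cancel, one_mul]
  have hlt : t.range < Γ := by
    refine lt_of_le_of_ne hTΓ ?_
    intro he
    apply hS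
    unfold IsDRR
    ext σ
    change σ ∈ Γ ↔ ∃ a : A, ∀ x : A, σ x = x * a
    rw [← he]
    constructor
    · rintro ⟨a, rfl⟩
      exact ⟨a, fun x => mul_comm _ _⟩
    · rintro ⟨a, ha⟩
      refine ⟨a, ?_⟩
      ext x
      rw [ha, ht, mul_comm]
  obtain ⟨G, hGΓ, hGmin⟩ := exists_minimal_le_of_wellFoundedLT (fun G => t.range < G) Γ hlt
  have hTG : t.range < G := hGmin.1
  have htG : ∀ a, t a ∈ G := fun a => hTG.le ⟨a, rfl⟩
  have hmin : ∀ H : Subgroup (Perm A), t.range ≤ H → H ≤ G → H = t.range ∨ H = G := by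
    intro H h1 h2
    rcases h1.eq_or_lt with h | h
    · exact Or.inl h.symm
    · exact Or.inr (le_antisymm h2 (hGmin.2 h h2))
  by_cases hN : ∃ g ∈ G, (∀ a, g ≠ t a) ∧ ∀ a, ∃ b, g * t a = t b * g
  · left
    obtain ⟨g, hg, hgt, hgn⟩ := hN
    set w := (t (g 1))⁻¹ * g with hw
    have hw1 : w 1 = 1 := by rw [hw, Perm.mul_apply, Equiv.Perm.inv_eq_iff_eq, ht, mul_one]
    have hwn : ∀ a, ∃ b, w * t a = t b * w := by
      intro a
      obtain ⟨b, hb⟩ := hgn a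
      refine ⟨b, ?_⟩
      rw [hw, mul_assoc, hb, ← map_inv, ← mul_assoc, htc, mul_assoc]
    have hwm : ∀ a x, w (a * x) = w a * w x := by
      intro a x
      obtain ⟨b, hb⟩ := hwn a
      have h1 := DFunLike.congr_fun hb x
      have h2 := DFunLike.congr_fun hb 1
      simp only [Perm.mul_apply, ht, hw1, mul_one] at h1 h2
      rw [h1, h2]
    refine ⟨MulEquiv.mk' w hwm, ?_, ?_⟩
    · intro h
      apply hgt (g 1)
      have : w = 1 := by
        ext x
        exact DFunLike.congr_fun h x
      rw [hw, inv_mul_eq_one] at this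
      exact this.symm
    · intro s
      have := hΓ1 w (hGΓ (G.mul_mem (G.inv_mem (htG _)) hg)) s
      rw [hw1, inv_one, mul_one] at this
      exact this
  · right
    push Not at hN
    obtain ⟨g0, hg0, hg0t⟩ := SetLike.exists_of_lt hTG
    have hg0t' : ∀ a, g0 ≠ t a := fun a h => hg0t ⟨a, h.symm⟩
    obtain ⟨Z, h, hZ, hh, hs⟩ := frobenius_core G htG ⟨g0, hg0, hg0t'⟩ (by
      change ∀ a b, ∀ w ∈ G, t a * w = w * t b → (∃ c, w = t c) ∨ ∀ g ∈ G, t a * g = g * t a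
      intro a b w hw hab
      let C : Subgroup (Perm A) := Subgroup.centralizer {t a} ⊓ G
      have hC : ∀ x, x ∈ C ↔ t a * x = x * t a ∧ x ∈ G := by
        intro x
        rw [Subgroup.mem_inf, Subgroup.mem_centralizer_singleton_iff, eq_comm]
      rcases hmin C (by rintro _ ⟨d, rfl⟩; exact (hC _).2 ⟨htc _ _, htG d⟩) inf_le_right with h | h
      · left
        by_contra! hcon
        obtain ⟨d, hd⟩ := hN w hw hcon
        have hmem : w * t d * w⁻¹ ∈ C := by
          refine (hC _).2 ⟨?_, G.mul_mem (G.mul_mem hw (htG d)) (G.inv_mem hw)⟩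
          have e : t a = w * t b * w⁻¹ := by rw [← hab]; group
          rw [e]
          calc w * t b * w⁻¹ * (w * t d * w⁻¹) = w * (t b * t d) * w⁻¹ := by group
            _ = _ := by rw [htc]; group
        rw [h] at hmem
        obtain ⟨e, he⟩ := hmem
        apply hd e
        rw [he]; group
      · right
        intro g hg
        rw [← h] at hg
        exact ((hC g).1 hg).1) (by
      change ∃ a, ¬ ∀ g ∈ G, t a * g = g * t a
      obtain ⟨a, ha⟩ := hN g0 hg0 hg0t'
      exact ⟨a, fun h => ha a (h g0 hg0).symm⟩)
    refine ⟨Z, h, hZ, hh, fun s hsZ => ?_⟩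
    obtain ⟨k, hk, he⟩ := hs s hsZ
    rw [← he]
    exact hΓ1 k (hGΓ hk) s

theorem count_non_DRR_subsets (A : Type) [Fintype A] [CommGroup A] (n : ℕ)
    (hn : n = Fintype.card A) :
    (Nat.card {S : Set A // ¬ IsDRR A S} : ℝ) ≤
      2 ^ ((3 * n / 4 : ℝ) + 2 * (Real.logb 2 n) ^ 2 + 1) := by
  subst hn
  exact count_of_structure A _ (structure_of_not_DRR A)
end

section
/- Let A be a finite group of order n. The number of subsets S of A for which there exist subgroups H and K with 1 < H ≤ K < A such that S \ K is a union of left (or, respectively, right) cosets of H is at most 2^{3n/4 + 2(log₂ n)²}. -/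
lemma two_mul_card_le_aux {A : Type} [Fintype A] [Group A] (H K : Subgroup A) (h : H < K) :
    2 * Nat.card H ≤ Nat.card K := by
  have hdvd : Nat.card H ∣ Nat.card K := Subgroup.card_dvd_of_le h.le
  obtain ⟨c, hc⟩ := hdvd
  have hKpos : 0 < Nat.card K := Nat.card_pos
  have hc2 : 2 ≤ c := by
    by_contra hlt
    have : c = 0 ∨ c = 1 := by omega
    rcases this with rfl | rfl
    · omega
    · have : H = K := Subgroup.eq_of_le_of_card_ge h.le (by omega)
      exact h.ne this
  rw [hc, mul_comm 2]
  exact Nat.mul_le_mul_left _ hc2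

lemma exists_gens_aux {A : Type} [Fintype A] [Group A] (K : Subgroup A) (k : ℕ) :
    ∃ f : Fin k → A, (∀ i, f i ∈ K) ∧ (Subgroup.closure (Set.range f) = K ∨
      2 ^ k ≤ Nat.card (Subgroup.closure (Set.range f))) := by
  induction k with
  | zero =>
    refine ⟨Fin.elim0, fun i => i.elim0, Or.inr ?_⟩
    have : 0 < Nat.card (Subgroup.closure (Set.range (Fin.elim0 : Fin 0 → A))) := Nat.card_pos
    simpa using this
  | succ k ih =>
    obtain ⟨f, hf, h⟩ := ih
    have hle : Subgroup.closure (Set.range f) ≤ K := by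
      rw [Subgroup.closure_le]
      rintro _ ⟨i, rfl⟩
      exact hf i
    by_cases heq : Subgroup.closure (Set.range f) = K
    · refine ⟨Fin.cons 1 f, ?_, Or.inl ?_⟩
      · intro i
        refine Fin.cases ?_ ?_ i
        · simp
        · intro j; simpa using hf j
      · rw [Fin.range_cons, Subgroup.closure_insert_one, heq]
    · have h2 := h.resolve_left heq
      obtain ⟨x, hxK, hx⟩ := SetLike.exists_of_lt (lt_of_le_of_ne hle heq)
      refine ⟨Fin.cons x f, ?_, Or.inr ?_⟩
      · intro i
        refine Fin.cases ?_ ?_ i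
        · simpa using hxK
        · intro j; simpa using hf j
      · rw [Fin.range_cons]
        have hlt : Subgroup.closure (Set.range f) < Subgroup.closure (insert x (Set.range f)) := by
          refine lt_of_le_of_ne (Subgroup.closure_mono (Set.subset_insert _ _)) ?_
          intro he
          apply hx
          rw [he]
          exact Subgroup.subset_closure (Set.mem_insert _ _)
        have := two_mul_card_le_aux _ _ hlt
        rw [pow_succ]
        omega

lemma family_card_aux {A : Type} [Fintype A] [Group A] (h : A) (K : Subgroup A)
    (h1 : h ≠ 1) (hK : h ∈ K) (hT : K ≠ ⊤) :
    {S : Set A | ∀ x ∈ S, x ∉ K → h * x ∈ S}.ncard ≤ 2 ^ (3 * Nat.card A / 4) := by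
  classical
  let s : Setoid A := QuotientGroup.rightRel (Subgroup.zpowers h)
  let o : A → A := fun x => (Quotient.mk s x).out
  have hzK : ∀ g ∈ Subgroup.zpowers h, g ∈ K := fun g hg =>
    (Subgroup.zpowers_le.mpr hK) hg
  have ho : ∀ x, x * (o x)⁻¹ ∈ Subgroup.zpowers h := fun x => by
    have : s (o x) x := Quotient.mk_out x
    exact QuotientGroup.rightRel_apply.mp this
  let T : Set A := {x | x ∉ K ∧ o x = x}
  have hoK : ∀ x, x ∉ K → o x ∉ K := by
    intro x hx hox
    apply hx
    have := K.mul_mem (hzK _ (ho x)) hox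
    simpa using this
  have hohx : ∀ x, o (h * x) = o x := by
    intro x
    have : Quotient.mk s (h * x) = Quotient.mk s x := by
      apply Quotient.sound
      refine QuotientGroup.rightRel_apply.mpr ?_
      have : x * (h * x)⁻¹ = h⁻¹ := by group
      rw [this]
      exact inv_mem (Subgroup.mem_zpowers h)
    simp only [o, this]
  have hoo : ∀ x, o (o x) = o x := by
    intro x
    simp only [o, Quotient.out_eq]
  have hTT : 2 * T.ncard + Nat.card K ≤ Nat.card A := by
    have hd : Disjoint T ((fun x => h * x) '' T) := by
      rw [Set.disjoint_left]
      rintro _ ⟨_, h2⟩ ⟨y, ⟨_, h4⟩, rfl⟩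
      simp only [hohx, h4] at h2
      exact h1 (by simpa using h2.symm)
    have hd2 : Disjoint (T ∪ ((fun x => h * x) '' T)) (K : Set A) := by
      rw [Set.disjoint_left]
      rintro x (⟨h2, _⟩ | ⟨y, ⟨h3, _⟩, rfl⟩) hx
      · exact h2 hx
      · exact h3 ((K.mul_mem_cancel_left hK).mp hx)
    have e1 := Set.ncard_union_eq hd (Set.toFinite _) (Set.toFinite _)
    have e2 := Set.ncard_union_eq hd2 (Set.toFinite _) (Set.toFinite _)
    have e3 : ((fun x => h * x) '' T).ncard = T.ncard :=
      Set.ncard_image_of_injective _ (mul_right_injective h)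
    have e4 := Set.ncard_le_card (T ∪ ((fun x => h * x) '' T) ∪ (K : Set A))
    have e5 : (K : Set A).ncard = Nat.card K := rfl
    omega
  have hK2 : 2 * Nat.card K ≤ Nat.card A := by
    have := two_mul_card_le_aux K ⊤ (lt_top_iff_ne_top.mpr hT)
    simpa using this
  have hU : ((K : Set A) ∪ T).ncard ≤ 3 * Nat.card A / 4 := by
    have := Set.ncard_union_le (K : Set A) T
    have e5 : (K : Set A).ncard = Nat.card K := rfl
    omega
  have hinv : ∀ S : Set A, (∀ x ∈ S, x ∉ K → h * x ∈ S) → ∀ g ∈ Subgroup.zpowers h,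
      ∀ x ∈ S, x ∉ K → g * x ∈ S := by
    intro S hS g hg x hx hxK
    rw [← mem_powers_iff_mem_zpowers] at hg
    obtain ⟨k, rfl⟩ := hg
    show h ^ k * x ∈ S
    induction k with
    | zero => simpa using hx
    | succ k ih =>
      rw [pow_succ', mul_assoc]
      exact hS _ ih (fun hc => hxK ((K.mul_mem_cancel_left (K.pow_mem hK k)).mp hc))
  have hiff : ∀ S : Set A, (∀ x ∈ S, x ∉ K → h * x ∈ S) → ∀ x, x ∉ K → (x ∈ S ↔ o x ∈ S) := by
    intro S hS x hx
    constructor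
    · intro hxS
      have := hinv S hS _ (inv_mem (ho x)) x hxS hx
      simpa using this
    · intro hxS
      have := hinv S hS _ (ho x) (o x) hxS (hoK x hx)
      simpa using this
  calc _ ≤ (𝒫 ((K : Set A) ∪ T)).ncard := by
        refine Set.ncard_le_ncard_of_injOn (fun S => S ∩ ((K : Set A) ∪ T)) ?_ ?_ (Set.toFinite _)
        · intro S _
          exact Set.inter_subset_right
        · intro S hS S' hS' he
          have key : ∀ y ∈ (K : Set A) ∪ T, (y ∈ S ↔ y ∈ S') := by
            intro y hy
            have := Set.ext_iff.mp he y
            simpa only [Set.mem_inter_iff, hy, and_true] using this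
          ext x
          by_cases hx : x ∈ K
          · exact key x (Or.inl hx)
          · rw [hiff S hS x hx, hiff S' hS' x hx]
            exact key _ (Or.inr ⟨hoK x hx, hoo x⟩)
    _ = 2 ^ ((K : Set A) ∪ T).ncard := Set.ncard_powerset _ (Set.toFinite _)
    _ ≤ _ := Nat.pow_le_pow_right (by norm_num) hU

lemma right_nat_aux (A : Type) [Fintype A] [Group A] :
    {S : Set A | ∃ H K : Subgroup A, H ≠ ⊥ ∧ H ≤ K ∧ K ≠ ⊤ ∧
        ∀ x ∈ S, x ∉ K → ∀ h ∈ H, h * x ∈ S}.ncard ≤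
      Nat.card A ^ (Nat.log 2 (Nat.card A) + 1) * 2 ^ (3 * Nat.card A / 4) := by
  classical
  set L := Nat.log 2 (Nat.card A) with hL
  let F : A × (Fin L → A) → Set (Set A) := fun p =>
    {S | p.1 ≠ 1 ∧ p.1 ∈ Subgroup.closure (Set.range p.2) ∧ Subgroup.closure (Set.range p.2) ≠ ⊤ ∧
      ∀ x ∈ S, x ∉ Subgroup.closure (Set.range p.2) → p.1 * x ∈ S}
  have hF : ∀ p, (F p).ncard ≤ 2 ^ (3 * Nat.card A / 4) := by
    intro p
    by_cases hp : p.1 ≠ 1 ∧ p.1 ∈ Subgroup.closure (Set.range p.2) ∧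
      Subgroup.closure (Set.range p.2) ≠ ⊤
    · refine le_trans (Set.ncard_le_ncard ?_ (Set.toFinite _))
        (family_card_aux p.1 _ hp.1 hp.2.1 hp.2.2)
      intro S hS
      exact hS.2.2.2
    · have : F p = ∅ := by
        ext S
        simp only [F, Set.mem_setOf_eq, Set.mem_empty_iff_false, iff_false]
        exact fun hS => hp ⟨hS.1, hS.2.1, hS.2.2.1⟩
      rw [this]
      simp
  have hsub : {S : Set A | ∃ H K : Subgroup A, H ≠ ⊥ ∧ H ≤ K ∧ K ≠ ⊤ ∧
        ∀ x ∈ S, x ∉ K → ∀ h ∈ H, h * x ∈ S} ⊆ ⋃ p, F p := by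
    rintro S ⟨H, K, hH, hHK, hK, hS⟩
    obtain ⟨⟨h, hh⟩, h1'⟩ := Subgroup.ne_bot_iff_exists_ne_one.mp hH
    have h1 : h ≠ 1 := fun hc => h1' (Subtype.ext hc)
    obtain ⟨f, hf, hfK⟩ := exists_gens_aux K L
    have hcl : Subgroup.closure (Set.range f) = K := by
      refine hfK.resolve_right ?_
      intro hc
      have hle : Subgroup.closure (Set.range f) ≤ K := by
        rw [Subgroup.closure_le]
        rintro _ ⟨i, rfl⟩
        exact hf i
      have h2 := Subgroup.card_le_of_le hle
      have h3 := two_mul_card_le_aux K ⊤ (lt_top_iff_ne_top.mpr hK)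
      rw [Subgroup.card_top] at h3
      have h4 := Nat.lt_pow_succ_log_self (b := 2) (by norm_num) (Nat.card A)
      rw [← hL, pow_succ] at h4
      omega
    refine Set.mem_iUnion.mpr ⟨(h, f), ?_⟩
    simp only [F, Set.mem_setOf_eq, hcl]
    exact ⟨h1, hHK hh, hK, fun x hx hxK => hS x hx hxK _ hh⟩
  calc _ ≤ (⋃ p, F p).ncard := Set.ncard_le_ncard hsub (Set.toFinite _)
    _ ≤ ∑ p, (F p).ncard := Set.ncard_iUnion_le_of_fintype F
    _ ≤ ∑ _p : A × (Fin L → A), 2 ^ (3 * Nat.card A / 4) := Finset.sum_le_sum fun p _ => hF p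
    _ = _ := by
      simp [Nat.card_eq_fintype_card, pow_succ']

lemma right_real_aux (A : Type) [Fintype A] [Group A] (n : ℕ)
    (hn : n = Fintype.card A) :
    (Nat.card {S : Set A // ∃ H K : Subgroup A, H ≠ ⊥ ∧ H ≤ K ∧ K ≠ ⊤ ∧
        ∀ x ∈ S, x ∉ K → ∀ h ∈ H, h * x ∈ S} : ℝ) ≤
      2 ^ ((3 * n / 4 : ℝ) + 2 * (Real.logb 2 n) ^ 2) := by
  have hnpos : 0 < n := hn ▸ Fintype.card_pos
  by_cases h1 : n = 1
  · have : IsEmpty {S : Set A // ∃ H K : Subgroup A, H ≠ ⊥ ∧ H ≤ K ∧ K ≠ ⊤ ∧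
        ∀ x ∈ S, x ∉ K → ∀ h ∈ H, h * x ∈ S} := by
      refine ⟨?_⟩
      rintro ⟨S, H, K, hH, _⟩
      have : Subsingleton A := Fintype.card_le_one_iff_subsingleton.mp (by omega)
      exact hH (Subsingleton.elim _ _)
    rw [Nat.card_of_isEmpty, Nat.cast_zero]
    positivity
  · have hb := right_nat_aux A
    rw [Nat.card_eq_fintype_card, ← hn] at hb
    have hb' : (Nat.card {S : Set A // ∃ H K : Subgroup A, H ≠ ⊥ ∧ H ≤ K ∧ K ≠ ⊤ ∧
        ∀ x ∈ S, x ∉ K → ∀ h ∈ H, h * x ∈ S} : ℝ) ≤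
        (n : ℝ) ^ (Nat.log 2 n + 1) * 2 ^ (3 * n / 4) := by exact_mod_cast hb
    refine hb'.trans ?_
    have hn0 : (0 : ℝ) < n := by exact_mod_cast hnpos
    have hlog1 : 1 ≤ Real.logb 2 n := by
      rw [Real.le_logb_iff_rpow_le (by norm_num) hn0, Real.rpow_one]
      exact_mod_cast (by omega : 2 ≤ n)
    have hlogL : (Nat.log 2 n : ℝ) ≤ Real.logb 2 n := by
      rw [Real.le_logb_iff_rpow_le (by norm_num) hn0, Real.rpow_natCast]
      exact_mod_cast Nat.pow_log_le_self 2 hnpos.ne'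
    have e1 : (n : ℝ) ^ (Nat.log 2 n + 1) =
        2 ^ (Real.logb 2 n * ((Nat.log 2 n + 1 : ℕ) : ℝ)) := by
      rw [Real.rpow_mul (by norm_num), Real.rpow_logb (by norm_num) (by norm_num) hn0,
        Real.rpow_natCast]
    have e2 : (2 : ℝ) ^ (3 * n / 4) = 2 ^ (((3 * n / 4 : ℕ)) : ℝ) := by
      rw [Real.rpow_natCast]
    rw [e1, e2, ← Real.rpow_add (by norm_num)]
    apply Real.rpow_le_rpow_of_exponent_le (by norm_num)
    have e3 : ((3 * n / 4 : ℕ) : ℝ) ≤ 3 * n / 4 := by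
      have := @Nat.cast_div_le ℝ _ _ _ (3 * n) 4
      push_cast at this
      exact this
    push_cast
    nlinarith

theorem count_generalized_wreath_subsets (A : Type) [Fintype A] [Group A] (n : ℕ)
    (hn : n = Fintype.card A) :
    -- right cosets `Hx`
    (Nat.card {S : Set A // ∃ H K : Subgroup A, H ≠ ⊥ ∧ H ≤ K ∧ K ≠ ⊤ ∧
        ∀ x ∈ S, x ∉ K → ∀ h ∈ H, h * x ∈ S} : ℝ) ≤
      2 ^ ((3 * n / 4 : ℝ) + 2 * (Real.logb 2 n) ^ 2) ∧
    -- left cosets `xH`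
    (Nat.card {S : Set A // ∃ H K : Subgroup A, H ≠ ⊥ ∧ H ≤ K ∧ K ≠ ⊤ ∧
        ∀ x ∈ S, x ∉ K → ∀ h ∈ H, x * h ∈ S} : ℝ) ≤
      2 ^ ((3 * n / 4 : ℝ) + 2 * (Real.logb 2 n) ^ 2) := by
  refine ⟨right_real_aux A n hn, le_trans ?_ (right_real_aux A n hn)⟩
  rw [Nat.cast_le]
  refine Nat.card_le_card_of_injective (fun S => ⟨(fun x : A => x⁻¹) ⁻¹' S.1, ?_⟩) ?_
  · obtain ⟨S, H, K, hH, hHK, hK, hS⟩ := S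
    refine ⟨H, K, hH, hHK, hK, ?_⟩
    intro x hx hxK h hh
    have := hS x⁻¹ hx (fun hc => hxK (by simpa using hc)) h⁻¹ (inv_mem hh)
    simpa [Set.mem_preimage, mul_inv_rev] using this
  · intro S S' he
    have he' := congrArg Subtype.val he
    apply Subtype.ext
    ext x
    have := Set.ext_iff.mp he' x⁻¹
    simpa using this
end

section
/- Let G be a finite group of order n. The number of subsets of G that are invariant under some non-identity automorphism of G is at most 2^{3n/4 + (log₂ n)²}. -/
theorem aux_gen (G : Type) [Fintype G] [Group G] :
    ∃ T : Finset G, 2 ^ T.card ≤ Fintype.card G ∧ Subgroup.closure (T : Set G) = ⊤ := by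
  classical
  let P : Finset (Finset G) :=
    Finset.univ.filter fun T => 2 ^ T.card ≤ Nat.card (Subgroup.closure (T : Set G))
  have hP : P.Nonempty := ⟨∅, by simp [P]⟩
  obtain ⟨T, hT, hmax⟩ := Finset.exists_max_image P Finset.card hP
  have hT' : 2 ^ T.card ≤ Nat.card (Subgroup.closure (T : Set G)) := by simpa [P] using hT
  refine ⟨T, ?_, ?_⟩
  · rw [← Nat.card_eq_fintype_card]
    exact hT'.trans (Subgroup.card_le_card_group _)
  · by_contra hne
    obtain ⟨g, hg⟩ : ∃ g, g ∉ Subgroup.closure (T : Set G) := by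
      by_contra! h
      exact hne ((Subgroup.eq_top_iff' _).2 h)
    have hgT : g ∉ T := fun h => hg (Subgroup.subset_closure h)
    have hle : Subgroup.closure (T : Set G) ≤ Subgroup.closure ((insert g T : Finset G) : Set G) :=
      Subgroup.closure_mono (by simp)
    have hgm : g ∈ Subgroup.closure ((insert g T : Finset G) : Set G) :=
      Subgroup.subset_closure (by simp)
    obtain ⟨k, hk⟩ := Subgroup.card_dvd_of_le hle
    have hpos : 0 < Nat.card (Subgroup.closure ((insert g T : Finset G) : Set G)) := Nat.card_pos
    have hk2 : 2 ≤ k := by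
      rcases k with _ | _ | k
      · omega
      · exfalso
        have := Subgroup.eq_of_le_of_card_ge hle (by omega)
        exact hg (this ▸ hgm)
      · omega
    have hin : insert g T ∈ P := by
      simp only [P, Finset.mem_filter, Finset.mem_univ, true_and]
      rw [Finset.card_insert_of_notMem hgT, hk, pow_succ]
      exact Nat.mul_le_mul hT' hk2
    have := hmax _ hin
    rw [Finset.card_insert_of_notMem hgT] at this
    omega

theorem aux_aut (G : Type) [Fintype G] [Group G] :
    ∃ d : ℕ, 2 ^ d ≤ Fintype.card G ∧ Nat.card (G ≃* G) ≤ Fintype.card G ^ d := by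
  classical
  obtain ⟨T, h1, h2⟩ := aux_gen G
  refine ⟨T.card, h1, ?_⟩
  have : Function.Injective (fun (φ : G ≃* G) (t : T) => φ t) := by
    intro φ ψ h
    have : φ.toMonoidHom = ψ.toMonoidHom := by
      apply MonoidHom.eq_of_eqOn_dense h2
      intro x hx
      exact congrFun h ⟨x, hx⟩
    ext x
    exact DFunLike.congr_fun this x
  have := Nat.card_le_card_of_injective _ this
  simpa using this

theorem aux_inv (G : Type) [Fintype G] [Group G] (φ : G ≃* G) (hφ : φ ≠ MulEquiv.refl G) :
    ∃ q : ℕ, 4 * q ≤ 3 * Fintype.card G ∧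
      Nat.card {S : Set G // ∀ x : G, x ∈ S ↔ φ x ∈ S} ≤ 2 ^ q := by
  classical
  let r : G → G → Prop := fun x y => φ x = y
  have : Finite (Quot r) := inferInstance
  let F : Subgroup G := φ.toMonoidHom.eqLocus (MonoidHom.id G)
  have hF : 2 * Nat.card F ≤ Fintype.card G := by
    obtain ⟨k, hk⟩ := Subgroup.card_subgroup_dvd_card F
    rw [← Nat.card_eq_fintype_card]
    have hpos : 0 < Nat.card G := Nat.card_pos
    have hk2 : 2 ≤ k := by
      rcases k with _ | _ | k
      · omega
      · exfalso
        have h := Subgroup.eq_top_of_card_eq F (by omega)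
        apply hφ
        ext x
        have : x ∈ F := h ▸ Subgroup.mem_top x
        exact this
      · omega
    rw [hk, mul_comm]
    exact Nat.mul_le_mul le_rfl hk2
  have hcls : ∀ q : Quot r, Quot.mk r (φ q.out) = q := fun q =>
    (Quot.sound (r := r) (a := q.out) rfl).symm.trans q.out_eq
  let f : Quot r ⊕ Quot r → G ⊕ F := Sum.elim (fun q => Sum.inl q.out)
    (fun q => if h : φ q.out = q.out then Sum.inr ⟨q.out, h⟩ else Sum.inl (φ q.out))
  have hf : Function.Injective f := by
    have key : ∀ p q : Quot r, f (Sum.inl p) ≠ f (Sum.inr q) := by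
      intro p q h
      simp only [f, Sum.elim_inl, Sum.elim_inr] at h
      split_ifs at h with h1
      have h := Sum.inl_injective h
      have hpq : p = q := by rw [← p.out_eq, h, hcls]
      subst hpq
      exact h1 h.symm
    rintro (p | p) (q | q) h
    · have h := Sum.inl_injective h
      rw [← p.out_eq, h, q.out_eq]
    · exact absurd h (key _ _)
    · exact absurd h.symm (key _ _)
    · simp only [f, Sum.elim_inr] at h
      congr 1
      split_ifs at h with h1 h2
      · have h := congrArg Subtype.val (Sum.inr_injective h)
        simp only at h
        rw [← p.out_eq, h, q.out_eq]
      · have h := Sum.inl_injective h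
        rw [← hcls p, h, hcls]
  have hc := Nat.card_le_card_of_injective f hf
  rw [Nat.card_sum, Nat.card_sum, Nat.card_eq_fintype_card (α := G)] at hc
  refine ⟨Nat.card (Quot r), by omega, ?_⟩
  let e : {S : Set G // ∀ x : G, x ∈ S ↔ φ x ∈ S} → (Quot r → Prop) := fun S =>
    Quot.lift (fun x => x ∈ S.1) (by
      rintro x y rfl
      exact propext (S.2 x))
  have he : Function.Injective e := by
    intro S S' h
    apply Subtype.ext
    ext x
    exact iff_of_eq (congrFun h (Quot.mk r x))
  have := Nat.card_le_card_of_injective e he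
  rw [Nat.card_fun] at this
  simpa using this

theorem count_subsets_invariant_under_some_nontrivial_automorphism
    (G : Type) [Fintype G] [Group G] (n : ℕ) (hn : n = Fintype.card G) :
    (Nat.card {S : Set G // ∃ φ : G ≃* G, φ ≠ MulEquiv.refl G ∧
        ∀ x : G, x ∈ S ↔ φ x ∈ S} : ℝ) ≤
      2 ^ ((3 * n / 4 : ℝ) + (Real.logb 2 n) ^ 2) := by
  classical
  have hn0 : 0 < n := hn ▸ Fintype.card_pos
  have hnR : (0 : ℝ) < n := by exact_mod_cast hn0
  obtain ⟨d, hd, hA⟩ := aux_aut G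
  rw [← hn] at hd hA
  have : Finite (G ≃* G) := inferInstance
  have : Fintype {φ : G ≃* G // φ ≠ MulEquiv.refl G} := Fintype.ofFinite _
  let g : {S : Set G // ∃ φ : G ≃* G, φ ≠ MulEquiv.refl G ∧ ∀ x : G, x ∈ S ↔ φ x ∈ S} →
      Σ φ : {φ : G ≃* G // φ ≠ MulEquiv.refl G}, {S : Set G // ∀ x : G, x ∈ S ↔ φ.1 x ∈ S} :=
    fun S => ⟨⟨S.2.choose, S.2.choose_spec.1⟩, ⟨S.1, S.2.choose_spec.2⟩⟩
  have hg : Function.Injective g := by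
    intro S S' h
    apply Subtype.ext
    exact congrArg (fun z : (Σ φ : {φ : G ≃* G // φ ≠ MulEquiv.refl G},
      {S : Set G // ∀ x : G, x ∈ S ↔ φ.1 x ∈ S}) => z.2.1) h
  have h1 := Nat.card_le_card_of_injective g hg
  rw [Nat.card_sigma] at h1
  have h2 : ∀ φ : {φ : G ≃* G // φ ≠ MulEquiv.refl G},
      (Nat.card {S : Set G // ∀ x : G, x ∈ S ↔ φ.1 x ∈ S} : ℝ) ≤ 2 ^ (3 * n / 4 : ℝ) := by
    intro φ
    obtain ⟨q, hq, hq2⟩ := aux_inv G φ.1 φ.2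
    rw [← hn] at hq
    have hqR : (4 : ℝ) * q ≤ 3 * n := by exact_mod_cast hq
    calc _ ≤ ((2 ^ q : ℕ) : ℝ) := by exact_mod_cast hq2
      _ = (2 : ℝ) ^ (q : ℝ) := by rw [Real.rpow_natCast]; norm_cast
      _ ≤ _ := Real.rpow_le_rpow_of_exponent_le (by norm_num) (by linarith)
  have h3 : Fintype.card {φ : G ≃* G // φ ≠ MulEquiv.refl G} ≤ n ^ d := by
    rw [← Nat.card_eq_fintype_card]
    exact (Nat.card_le_card_of_injective _ Subtype.val_injective).trans hA
  have hdl : (d : ℝ) ≤ Real.logb 2 n := by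
    rw [Real.le_logb_iff_rpow_le (by norm_num) hnR, Real.rpow_natCast]
    exact_mod_cast hd
  have h4 : ((n ^ d : ℕ) : ℝ) ≤ 2 ^ ((Real.logb 2 n) ^ 2) := by
    have : (n : ℝ) = 2 ^ (Real.logb 2 n) := (Real.rpow_logb (by norm_num) (by norm_num) hnR).symm
    have hd0 : (0 : ℝ) ≤ d := Nat.cast_nonneg d
    calc ((n ^ d : ℕ) : ℝ) = ((2 : ℝ) ^ (Real.logb 2 n)) ^ (d : ℝ) := by
          rw [← this, Real.rpow_natCast]; norm_cast
      _ = 2 ^ (Real.logb 2 n * d) := by rw [← Real.rpow_mul (by norm_num)]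
      _ ≤ _ := Real.rpow_le_rpow_of_exponent_le (by norm_num) (by nlinarith)
  calc _ ≤ ((∑ φ : {φ : G ≃* G // φ ≠ MulEquiv.refl G},
        Nat.card {S : Set G // ∀ x : G, x ∈ S ↔ φ.1 x ∈ S} : ℕ) : ℝ) := by exact_mod_cast h1
    _ ≤ ∑ φ : {φ : G ≃* G // φ ≠ MulEquiv.refl G}, (2 : ℝ) ^ (3 * n / 4 : ℝ) := by
        push_cast
        exact Finset.sum_le_sum fun φ _ => h2 φ
    _ = (Fintype.card {φ : G ≃* G // φ ≠ MulEquiv.refl G} : ℝ) * (2 : ℝ) ^ (3 * n / 4 : ℝ) := by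
        rw [Finset.sum_const, Finset.card_univ, nsmul_eq_mul]
    _ ≤ 2 ^ ((Real.logb 2 n) ^ 2) * (2 : ℝ) ^ (3 * n / 4 : ℝ) := by
        apply mul_le_mul_of_nonneg_right _ (by positivity)
        exact le_trans (by exact_mod_cast h3) h4
    _ = _ := by rw [← Real.rpow_add (by norm_num), add_comm]
end

section
/- Let A be an abelian group of order n. The number of quadruples (C, Z, S′, S″) such that A = C × Z (an internal direct product of subgroups), C is a cyclic group of order t ≥ 4, Z is an elementary abelian 2-group, S′ ∈ {C, ∅, {1}, C \ {1}}, and S″ ⊆ Z, is at most 2^{n/4 + 2 log₂(n) − 1}. -/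
/-- Number of nontrivial-order cyclic subgroups: each has two distinct generators. -/
lemma cq_card_cyclic (A : Type) [Fintype A] [CommGroup A] :
    Nat.card {C : Subgroup A // IsCyclic C ∧ 4 ≤ Nat.card C} * 2 ≤ Nat.card A := by
  have hg : ∀ C : {C : Subgroup A // IsCyclic C ∧ 4 ≤ Nat.card C},
      ∃ g : A, Subgroup.zpowers g = C.1 := by
    rintro ⟨C, hC, _⟩
    exact (Subgroup.isCyclic_iff_exists_zpowers_eq_top C).1 hC
  choose g hg using hg
  have hne : ∀ C, g C ≠ (g C)⁻¹ := by
    intro C h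
    have h4 := C.2.2
    rw [← hg C, Nat.card_zpowers] at h4
    have h2 : (g C) ^ 2 = 1 := by
      rw [pow_two]; nth_rewrite 2 [h]; simp
    have := Nat.le_of_dvd (by norm_num) (orderOf_dvd_of_pow_eq_one h2)
    omega
  let f : {C : Subgroup A // IsCyclic C ∧ 4 ≤ Nat.card C} × Bool → A :=
    fun p => if p.2 then g p.1 else (g p.1)⁻¹
  have hf : ∀ p, Subgroup.zpowers (f p) = p.1.1 := by
    rintro ⟨C, b⟩
    cases b <;> simp [f, hg]
  have hinj : Function.Injective f := by
    rintro ⟨C, b⟩ ⟨D, c⟩ h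
    have hCD : C = D := by
      apply Subtype.ext
      rw [← hf (C, b), ← hf (D, c), h]
    subst hCD
    have := hne C
    cases b <;> cases c <;> simp_all [f]
  have := Nat.card_le_card_of_injective f hinj
  rw [Nat.card_prod] at this
  simpa using this

lemma cq_exists_char (A : Type) [Fintype A] [CommGroup A] (C Z : Subgroup A)
    (χ : C →* ℂˣ) (hχ : Function.Injective χ) (h1 : C ⊓ Z = ⊥) (h2 : C ⊔ Z = ⊤) :
    ∃ ψ : A →* ℂˣ, ψ.ker = Z ∧ ∀ c : C, ψ c = χ c := by
  let q : C →* A ⧸ Z := (QuotientGroup.mk' Z).comp C.subtype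
  have hq : Function.Bijective q := by
    constructor
    · rw [injective_iff_map_eq_one]
      intro c hc
      have : (c : A) ∈ Z := (QuotientGroup.eq_one_iff _).1 hc
      have : (c : A) ∈ C ⊓ Z := ⟨c.2, this⟩
      rw [h1] at this
      exact Subtype.ext (Subgroup.mem_bot.1 this)
    · intro x
      obtain ⟨a, rfl⟩ := QuotientGroup.mk'_surjective Z x
      have : a ∈ C ⊔ Z := by rw [h2]; trivial
      obtain ⟨c, hc, z, hz, rfl⟩ := Subgroup.mem_sup.1 this
      refine ⟨⟨c, hc⟩, ?_⟩
      have hz' : QuotientGroup.mk' Z z = 1 := (QuotientGroup.eq_one_iff _).2 hz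
      simp only [map_mul, hz', mul_one]
      rfl
  let e := MulEquiv.ofBijective q hq
  refine ⟨χ.comp (e.symm.toMonoidHom.comp (QuotientGroup.mk' Z)), ?_, ?_⟩
  · ext a
    rw [MonoidHom.mem_ker]
    change χ (e.symm (QuotientGroup.mk' Z a)) = 1 ↔ _
    rw [← map_one χ, hχ.eq_iff, ← map_one e.symm, e.symm.injective.eq_iff]
    exact QuotientGroup.eq_one_iff a
  · intro c
    change χ (e.symm (q c)) = _
    congr 1
    exact e.symm_apply_apply c

lemma cq_card_compl (A : Type) [Fintype A] [CommGroup A] (C : Subgroup A)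
    (hC : IsCyclic C) (h4 : 4 ≤ Nat.card C) :
    Nat.card {Z : Subgroup A // C ⊓ Z = ⊥ ∧ C ⊔ Z = ⊤} * 4 ≤ Nat.card A := by
  rcases isEmpty_or_nonempty {Z : Subgroup A // C ⊓ Z = ⊥ ∧ C ⊔ Z = ⊤} with hE | ⟨⟨Z0, hZ1, hZ2⟩⟩
  · simp
  have hcard : Nat.card C * Nat.card Z0 = Nat.card A := by
    apply Subgroup.IsComplement.card_mul_card
    apply Subgroup.isComplement'_of_disjoint_and_mul_eq_univ
    · exact disjoint_iff.2 hZ1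
    · rw [← Subgroup.mul_normal, hZ2]; rfl
  have hχ : ∃ χ : C →* ℂˣ, Function.Injective χ := by
    have : NeZero (Nat.card C) := ⟨by omega⟩
    have hc : Nat.card C = Nat.card (rootsOfUnity (Nat.card C) ℂ) := by
      exact (HasEnoughRootsOfUnity.natCard_rootsOfUnity ℂ (Nat.card C)).symm
    let e : C ≃* rootsOfUnity (Nat.card C) ℂ := mulEquivOfCyclicCardEq hc
    exact ⟨(Subgroup.subtype _).comp e.toMonoidHom,
      (Subgroup.subtype_injective _).comp e.injective⟩
  obtain ⟨χ, hχ⟩ := hχ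
  have hex : ∀ Z : {Z : Subgroup A // C ⊓ Z = ⊥ ∧ C ⊔ Z = ⊤},
      ∃ ψ : A →* ℂˣ, ψ.ker = Z.1 ∧ ∀ c : C, ψ c = χ c := fun Z =>
    cq_exists_char A C Z.1 χ hχ Z.2.1 Z.2.2
  choose ψ hk hr using hex
  have hinj : Function.Injective (fun Z => (ψ Z).comp Z0.subtype) := by
    intro Z W h
    have hψ : ψ Z = ψ W := by
      ext a
      have : a ∈ C ⊔ Z0 := by rw [hZ2]; trivial
      obtain ⟨c, hc, z, hz, rfl⟩ := Subgroup.mem_sup.1 this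
      have e1 := (hr Z ⟨c, hc⟩).trans (hr W ⟨c, hc⟩).symm
      have e2 : ψ Z z = ψ W z := DFunLike.congr_fun h ⟨z, hz⟩
      simp only [map_mul] 
      rw [e2]
      simp only at e1
      rw [e1]
    apply Subtype.ext
    rw [← hk Z, ← hk W, hψ]
  have : NeZero (Monoid.exponent Z0) := ⟨Monoid.exponent_ne_zero_of_finite⟩
  have hdual : Nat.card (Z0 →* ℂˣ) = Nat.card Z0 :=
    CommGroup.card_monoidHom_of_hasEnoughRootsOfUnity Z0 ℂ
  have : Finite (Z0 →* ℂˣ) := Nat.finite_of_card_ne_zero (by rw [hdual]; exact Nat.card_pos.ne')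
  have h := Nat.card_le_card_of_injective _ hinj
  rw [hdual] at h
  nlinarith [Nat.zero_le (Nat.card Z0)]

lemma cq_card_le_of_fibers {α β : Type} [Finite α] [Finite β] (f : α → β) (k : ℕ)
    (h : ∀ b, Nat.card {a // f a = b} ≤ k) : Nat.card α ≤ Nat.card β * k := by
  have := Fintype.ofFinite β
  rw [← Nat.card_congr (Equiv.sigmaFiberEquiv f), Nat.card_sigma]
  calc _ ≤ ∑ b : β, k := Finset.sum_le_sum fun b _ => h b
    _ = _ := by simp

lemma cq_card_pairs (A : Type) [Fintype A] [CommGroup A] :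
    Nat.card {p : Subgroup A × Subgroup A // p.1 ⊓ p.2 = ⊥ ∧ p.1 ⊔ p.2 = ⊤ ∧
      IsCyclic p.1 ∧ 4 ≤ Nat.card p.1} * 8 ≤ Nat.card A ^ 2 := by
  have h1 := cq_card_cyclic A
  have h2 := cq_card_le_of_fibers
    (fun p : {p : Subgroup A × Subgroup A // p.1 ⊓ p.2 = ⊥ ∧ p.1 ⊔ p.2 = ⊤ ∧
      IsCyclic p.1 ∧ 4 ≤ Nat.card p.1} =>
      (⟨p.1.1, p.2.2.2⟩ : {C : Subgroup A // IsCyclic C ∧ 4 ≤ Nat.card C})) (Nat.card A / 4) ?_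
  · have h3 : Nat.card A / 4 * 4 ≤ Nat.card A := Nat.div_mul_le_self _ _
    have := Nat.mul_le_mul h1 h3
    nlinarith
  · rintro ⟨C, hC, h4⟩
    rw [Nat.le_div_iff_mul_le (by norm_num)]
    refine le_trans (Nat.mul_le_mul_right 4 ?_) (cq_card_compl A C hC h4)
    have key : ∀ p : {p : Subgroup A × Subgroup A // p.1 ⊓ p.2 = ⊥ ∧ p.1 ⊔ p.2 = ⊤ ∧
      IsCyclic p.1 ∧ 4 ≤ Nat.card p.1}, (⟨p.1.1, p.2.2.2⟩ : {C : Subgroup A // IsCyclic C ∧ 4 ≤ Nat.card C}) = ⟨C, hC, h4⟩ → p.1.1 = C :=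
      fun p h => congrArg Subtype.val h
    apply Nat.card_le_card_of_injective (fun a => ⟨a.1.1.2, by
      have h5 := a.1.2.1
      have h6 := a.1.2.2.1
      rw [key _ a.2] at h5 h6
      exact ⟨h5, h6⟩⟩)
    intro a b h
    have h' : a.1.1.2 = b.1.1.2 := congrArg Subtype.val h
    have h'' : a.1.1.1 = b.1.1.1 := (key _ a.2).trans (key _ b.2).symm
    exact Subtype.ext (Subtype.ext (Prod.ext h'' h'))

lemma cq_card_fiber (A : Type) [Fintype A] [CommGroup A] (C Z : Subgroup A) :
    Nat.card (({(C : Set A), ∅, {1}, (C : Set A) \ {1}} : Set (Set A)) × {S : Set A // S ⊆ Z}) ≤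
      4 * 2 ^ Nat.card Z := by
  rw [Nat.card_prod]
  apply Nat.mul_le_mul
  · rw [Nat.card_coe_set_eq]
    refine (Set.ncard_insert_le _ _).trans ?_
    have h1 := Set.ncard_insert_le (∅ : Set A) {{1}, (C : Set A) \ {1}}
    have h2 := Set.ncard_insert_le ({1} : Set A) {(C : Set A) \ {1}}
    rw [Set.ncard_singleton] at h2
    omega
  · have := Set.ncard_powerset (Z : Set A)
    exact this.le

theorem count_quadruples (A : Type) [Fintype A] [CommGroup A] (n : ℕ)
    (hn : n = Fintype.card A) :
    (Nat.card {x : Subgroup A × Subgroup A × Set A × Set A //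
        -- `A = C × Z` is an internal direct product
        x.1 ⊓ x.2.1 = ⊥ ∧ x.1 ⊔ x.2.1 = ⊤ ∧
        -- `C` is cyclic of order `t ≥ 4`
        IsCyclic x.1 ∧ 4 ≤ Nat.card x.1 ∧
        -- `Z` is an elementary abelian 2-group
        (∀ z ∈ x.2.1, z * z = 1) ∧
        -- `S' ∈ {C, ∅, {1}, C \ {1}}`
        x.2.2.1 ∈ ({(x.1 : Set A), ∅, {1}, (x.1 : Set A) \ {1}} : Set (Set A)) ∧
        -- `S'' ⊆ Z`
        x.2.2.2 ⊆ (x.2.1 : Set A)} : ℝ) ≤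
      2 ^ ((n : ℝ) / 4 + 2 * Real.logb 2 n - 1) := by
  rw [← Nat.card_eq_fintype_card] at hn
  have hpairs := cq_card_pairs A
  have hmain := cq_card_le_of_fibers
    (fun x : {x : Subgroup A × Subgroup A × Set A × Set A //
        x.1 ⊓ x.2.1 = ⊥ ∧ x.1 ⊔ x.2.1 = ⊤ ∧
        IsCyclic x.1 ∧ 4 ≤ Nat.card x.1 ∧
        (∀ z ∈ x.2.1, z * z = 1) ∧
        x.2.2.1 ∈ ({(x.1 : Set A), ∅, {1}, (x.1 : Set A) \ {1}} : Set (Set A)) ∧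
        x.2.2.2 ⊆ (x.2.1 : Set A)} =>
      (⟨(x.1.1, x.1.2.1), x.2.1, x.2.2.1, x.2.2.2.1, x.2.2.2.2.1⟩ :
        {p : Subgroup A × Subgroup A // p.1 ⊓ p.2 = ⊥ ∧ p.1 ⊔ p.2 = ⊤ ∧
          IsCyclic p.1 ∧ 4 ≤ Nat.card p.1})) (4 * 2 ^ (n / 4)) ?_
  · have hnpos : 0 < (n : ℝ) := by
      rw [hn]; exact_mod_cast Nat.card_pos
    have hrhs : (2 : ℝ) ^ ((n : ℝ) / 4 + 2 * Real.logb 2 n - 1) =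
        2 ^ ((n : ℝ) / 4) * (n : ℝ) ^ 2 / 2 := by
      rw [Real.rpow_sub (by norm_num), Real.rpow_add (by norm_num), Real.rpow_one,
        mul_comm (2 : ℝ) (Real.logb 2 n), Real.rpow_mul (by norm_num),
        Real.rpow_logb (by norm_num) (by norm_num) hnpos]
      norm_num
    rw [hrhs]
    have hpow : (2 : ℝ) ^ (n / 4) ≤ 2 ^ ((n : ℝ) / 4) := by
      rw [← Real.rpow_natCast]
      apply Real.rpow_le_rpow_of_exponent_le (by norm_num)
      exact_mod_cast (Nat.cast_div_le (α := ℝ) (m := n) (n := 4))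
    rw [← hn] at hpairs
    have hp : (Nat.card {p : Subgroup A × Subgroup A // p.1 ⊓ p.2 = ⊥ ∧ p.1 ⊔ p.2 = ⊤ ∧
      IsCyclic p.1 ∧ 4 ≤ Nat.card p.1} : ℝ) * 8 ≤ (n : ℝ) ^ 2 := by exact_mod_cast hpairs
    have hm := (Nat.cast_le (α := ℝ)).2 hmain
    push_cast at hm
    refine hm.trans ?_
    have h0 : (0 : ℝ) ≤ 2 ^ (n / 4) := by positivity
    have := mul_le_mul hp hpow h0 (by positivity)
    linarith
  · rintro ⟨⟨C, Z⟩, h1, h2, hC, h4⟩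
    have hcard : Nat.card C * Nat.card Z = Nat.card A := by
      apply Subgroup.IsComplement.card_mul_card
      apply Subgroup.isComplement'_of_disjoint_and_mul_eq_univ
      · exact disjoint_iff.2 h1
      · rw [← Subgroup.mul_normal]
        change ((C ⊔ Z : Subgroup A) : Set A) = _
        have h2' : C ⊔ Z = ⊤ := h2
        rw [h2']; rfl
    have hZ : Nat.card Z ≤ n / 4 := by
      rw [Nat.le_div_iff_mul_le (by norm_num), hn, ← hcard, mul_comm]
      exact Nat.mul_le_mul_right _ h4
    refine le_trans ?_ ((cq_card_fiber A C Z).trans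
      (Nat.mul_le_mul_left 4 (Nat.pow_le_pow_right (by norm_num) hZ)))
    have key : ∀ a : {a : {x : Subgroup A × Subgroup A × Set A × Set A //
        x.1 ⊓ x.2.1 = ⊥ ∧ x.1 ⊔ x.2.1 = ⊤ ∧
        IsCyclic x.1 ∧ 4 ≤ Nat.card x.1 ∧
        (∀ z ∈ x.2.1, z * z = 1) ∧
        x.2.2.1 ∈ ({(x.1 : Set A), ∅, {1}, (x.1 : Set A) \ {1}} : Set (Set A)) ∧
        x.2.2.2 ⊆ (x.2.1 : Set A)} //
        (⟨(a.1.1, a.1.2.1), a.2.1, a.2.2.1, a.2.2.2.1, a.2.2.2.2.1⟩ :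
        {p : Subgroup A × Subgroup A // p.1 ⊓ p.2 = ⊥ ∧ p.1 ⊔ p.2 = ⊤ ∧
          IsCyclic p.1 ∧ 4 ≤ Nat.card p.1}) = ⟨(C, Z), h1, h2, hC, h4⟩},
        a.1.1.1 = C ∧ a.1.1.2.1 = Z := fun a =>
      Prod.mk.injEq .. ▸ congrArg Subtype.val a.2
    apply Nat.card_le_card_of_injective (fun a =>
      (⟨a.1.1.2.2.1, by have h5 := a.1.2.2.2.2.2.2.1; rw [(key a).1] at h5; exact h5⟩,
       ⟨a.1.1.2.2.2, by have h5 := a.1.2.2.2.2.2.2.2; rw [(key a).2] at h5; exact h5⟩))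
    intro a b h
    have e1 : a.1.1.2.2.1 = b.1.1.2.2.1 := congrArg (fun q => q.1.1) h
    have e2 : a.1.1.2.2.2 = b.1.1.2.2.2 := congrArg (fun q => q.2.1) h
    have e3 := (key a).1.trans (key b).1.symm
    have e4 := (key a).2.trans (key b).2.symm
    exact Subtype.ext (Subtype.ext (Prod.ext e3 (Prod.ext e4 (Prod.ext e1 e2))))
end

section
/- Let n be a positive integer that is not a power of 2, let A be an abelian group of order n, and let m be the number of elements of order at most 2 in A. Then the number of inverse-closed subsets S of A for which there exist subgroups H and K with 1 < H ≤ K < A such that S \ K is a union of cosets of H is at most 2^{m/2 + 11n/24 + 2(log₂ n)²}. -/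
open scoped Pointwise

open Classical in
lemma aux_card_quot {A : Type} [Fintype A] (r : Setoid A) (w : A → ℝ)
    (hw : ∀ x, 1 ≤ w x * ((Finset.univ.filter (fun y => r x y)).card : ℝ)) :
    (Fintype.card (Quotient r) : ℝ) ≤ ∑ x, w x := by
  have hpos : ∀ x : A, (0:ℝ) < ((Finset.univ.filter (fun y => r x y)).card : ℝ) := by
    intro x
    have : 0 < (Finset.univ.filter (fun y => r x y)).card :=
      Finset.card_pos.mpr ⟨x, by simpa using r.refl x⟩
    exact_mod_cast this
  rw [← Finset.sum_fiberwise Finset.univ (fun x => (Quotient.mk r x)) w]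
  have : (Fintype.card (Quotient r) : ℝ) = ∑ q : Quotient r, (1:ℝ) := by simp
  rw [this]
  apply Finset.sum_le_sum
  intro q _
  induction q using Quotient.inductionOn with
  | h x =>
    have hset : (Finset.univ.filter (fun y => Quotient.mk r y = Quotient.mk r x)) =
        Finset.univ.filter (fun y => r x y) := by
      ext y
      simp only [Finset.mem_filter, Finset.mem_univ, true_and]
      rw [Quotient.eq]
      exact ⟨fun h => r.symm h, fun h => r.symm h⟩
    rw [hset]
    have h2 : ∀ y ∈ Finset.univ.filter (fun y => r x y),
        1 / ((Finset.univ.filter (fun y => r x y)).card : ℝ) ≤ w y := by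
      intro y hy
      simp only [Finset.mem_filter, Finset.mem_univ, true_and] at hy
      have : Finset.univ.filter (fun z => r x z) = Finset.univ.filter (fun z => r y z) := by
        ext z
        simp only [Finset.mem_filter, Finset.mem_univ, true_and]
        exact ⟨fun h => r.trans (r.symm hy) h, fun h => r.trans hy h⟩
      rw [this, div_le_iff₀ (hpos y)]
      exact hw y
    have h3 := Finset.card_nsmul_le_sum _ _ _ h2
    rw [nsmul_eq_mul, mul_one_div_cancel (hpos x).ne'] at h3
    exact h3

open Classical in
lemma aux_card_family {A : Type} [Fintype A] (F : Set A → Prop) [DecidablePred F] (w : A → ℝ)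
    (hw : ∀ x, ∃ C : Finset A, 1 ≤ w x * (C.card : ℝ) ∧
      ∀ y ∈ C, ∀ S, F S → (x ∈ S ↔ y ∈ S)) (hw0 : ∀ x, 0 ≤ w x) :
    ((Finset.univ.filter F).card : ℝ) ≤ 2 ^ (∑ x, w x) := by
  let r : Setoid A := ⟨fun x y => ∀ S, F S → (x ∈ S ↔ y ∈ S),
    ⟨fun x S _ => Iff.rfl, fun h S hS => (h S hS).symm,
      fun h h' S hS => (h S hS).trans (h' S hS)⟩⟩
  have h1 : (Fintype.card (Quotient r) : ℝ) ≤ ∑ x, w x := by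
    apply aux_card_quot
    intro x
    obtain ⟨C, hC, hC'⟩ := hw x
    refine hC.trans (mul_le_mul_of_nonneg_left ?_ (hw0 x))
    norm_cast
    apply Finset.card_le_card
    intro y hy
    simp only [Finset.mem_filter, Finset.mem_univ, true_and]
    exact hC' y hy
  have h2 : (Finset.univ.filter F).card ≤ 2 ^ Fintype.card (Quotient r) := by
    have : (Finset.univ.filter F) ⊆
        (Finset.univ : Finset (Set (Quotient r))).image (fun T => Quotient.mk r ⁻¹' T) := by
      intro S hS
      simp only [Finset.mem_filter, Finset.mem_univ, true_and] at hS
      simp only [Finset.mem_image, Finset.mem_univ, true_and]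
      refine ⟨Quotient.mk r '' S, ?_⟩
      ext x
      constructor
      · rintro ⟨y, hy, hxy⟩
        have := Quotient.exact hxy
        exact (this S hS).1 hy
      · intro hx
        exact ⟨x, hx, rfl⟩
    refine (Finset.card_le_card this).trans (Finset.card_image_le.trans ?_)
    rw [Finset.card_univ, Fintype.card_set]
  calc ((Finset.univ.filter F).card : ℝ) ≤ (2:ℝ) ^ Fintype.card (Quotient r) := by
        exact_mod_cast h2
    _ = (2:ℝ) ^ (Fintype.card (Quotient r) : ℝ) := by rw [Real.rpow_natCast]
    _ ≤ _ := Real.rpow_le_rpow_of_exponent_le (by norm_num) h1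

lemma aux_m_le (n : ℕ) (hn2 : ∀ k : ℕ, n ≠ 2 ^ k)
    (A : Type) [Fintype A] [CommGroup A] (hn : n = Fintype.card A) :
    3 * Nat.card {a : A // a * a = 1} ≤ n := by
  let T : Subgroup A := (powMonoidHom 2 : A →* A).ker
  have hT : Nat.card {a : A // a * a = 1} = Nat.card T := by
    apply Nat.card_congr
    apply Equiv.subtypeEquivRight
    intro a
    simp [T, MonoidHom.mem_ker, pow_two]
  have hp : IsPGroup 2 T := by
    rintro ⟨a, ha⟩
    refine ⟨1, ?_⟩
    ext
    simpa [T, MonoidHom.mem_ker] using ha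
  haveI : Fact (Nat.Prime 2) := ⟨Nat.prime_two⟩
  obtain ⟨k, hk⟩ := IsPGroup.iff_card.mp hp
  have hi := T.card_mul_index
  rw [Nat.card_eq_fintype_card (α := A), ← hn] at hi
  rw [hT]
  have h0 : T.index ≠ 0 := T.index_ne_zero_of_finite
  have h1 : T.index ≠ 1 := by
    intro h; rw [h, hk] at hi; exact hn2 k (by omega)
  have h2 : T.index ≠ 2 := by
    intro h; rw [h, hk] at hi; exact hn2 (k+1) (by rw [pow_succ]; omega)
  have : 3 ≤ T.index := by omega
  nlinarith

set_option maxHeartbeats 1600000 in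
open Classical in
lemma aux_pair {A : Type} [Fintype A] [CommGroup A] (H K : Subgroup A) (hHK : H ≤ K)
    (hK : K ≠ ⊤) (hH : Nat.card H = 2 ∨ (Odd (Nat.card H) ∧ 3 ≤ Nat.card H))
    (m : ℕ) (hm : m = Nat.card {a : A // a * a = 1}) (hmn : 3 * m ≤ Fintype.card A) :
    (((Finset.univ : Finset (Set A)).filter (fun S => S⁻¹ = S ∧
      ∀ x ∈ S, x ∉ K → ∀ h ∈ H, x * h ∈ S)).card : ℝ) ≤
      2 ^ ((m : ℝ) / 2 + 11 * (Fintype.card A : ℝ) / 24) := by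
  set p := Nat.card H with hp
  have hp2 : 2 ≤ p := by omega
  have hp0 : (0:ℝ) < p := by positivity
  let HF : Finset A := Finset.univ.filter (· ∈ H)
  have hHF : HF.card = p := by
    rw [hp, Nat.card_eq_fintype_card, Fintype.card_subtype]
  let w : A → ℝ := fun x => (if x ∈ K then 1/2 else 0) + (if x ∈ K ∧ x * x = 1 then 1/2 else 0)
    + (if x ∉ K then 1/(2*(p:ℝ)) else 0) + (if x ∉ K ∧ x * x ∈ H then 1/(2*(p:ℝ)) else 0)
  refine (aux_card_family (fun S : Set A => S⁻¹ = S ∧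
      ∀ x ∈ S, x ∉ K → ∀ h ∈ H, x * h ∈ S) w ?_ ?_).trans ?_
  · intro x
    by_cases hx : x ∈ K
    · refine ⟨{x, x⁻¹}, ?_, ?_⟩
      · by_cases hxx : x * x = 1
        · have : 1 ≤ (({x, x⁻¹} : Finset A).card : ℝ) := by
            exact_mod_cast Finset.card_pos.mpr ⟨x, by simp⟩
          simp only [w, hx, hxx]
          norm_num
        · have : x ≠ x⁻¹ := fun h => hxx (by nth_rewrite 2 [h]; simp)
          rw [Finset.card_pair this]
          simp [w, hx, hxx]
      · rintro y hy S ⟨hS, -⟩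
        simp only [Finset.mem_insert, Finset.mem_singleton] at hy
        rcases hy with rfl | rfl
        · rfl
        · nth_rewrite 1 [← hS]; simp
    · have key : ∀ S : Set A, (S⁻¹ = S ∧ ∀ x ∈ S, x ∉ K → ∀ h ∈ H, x * h ∈ S) →
          ∀ x ∉ K, ∀ h ∈ H, (x ∈ S ↔ x * h ∈ S) := by
        rintro S ⟨-, hS⟩ x hx h hh
        refine ⟨fun hxS => hS x hxS hx h hh, fun hxS => ?_⟩
        have := hS (x*h) hxS (fun hc => hx ((K.mul_mem_cancel_right (hHK hh)).1 hc)) h⁻¹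
          (H.inv_mem hh)
        simpa using this
      have c1 : (HF.image (x * ·)).card = p := by
        rw [Finset.card_image_of_injective _ (mul_right_injective x), hHF]
      have c2 : (HF.image (x⁻¹ * ·)).card = p := by
        rw [Finset.card_image_of_injective _ (mul_right_injective x⁻¹), hHF]
      refine ⟨HF.image (x * ·) ∪ HF.image (x⁻¹ * ·), ?_, ?_⟩
      · by_cases hxx : x * x ∈ H
        · have h1 : (p:ℝ) ≤ ((HF.image (x * ·) ∪ HF.image (x⁻¹ * ·)).card : ℝ) := by
            rw [← c1]
            exact_mod_cast Finset.card_le_card Finset.subset_union_left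
          have h2 : w x = 1 / p := by
            simp [w, hx, hxx]; field_simp; norm_num
          rw [h2, one_div, inv_mul_eq_div, le_div_iff₀ hp0]
          linarith
        · have hd : Disjoint (HF.image (x * ·)) (HF.image (x⁻¹ * ·)) := by
            rw [Finset.disjoint_left]
            intro y hy hy'
            simp only [HF, Finset.mem_image, Finset.mem_filter, Finset.mem_univ, true_and] at hy hy'
            obtain ⟨a, ha, rfl⟩ := hy
            obtain ⟨b, hb, hab⟩ := hy'
            apply hxx
            have : x * x = b * a⁻¹ := by
              rw [eq_mul_inv_iff_mul_eq, mul_assoc, ← hab]; simp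
            rw [this]
            exact H.mul_mem hb (H.inv_mem ha)
          rw [Finset.card_union_of_disjoint hd, c1, c2]
          have h2 : w x = 1 / (2 * p) := by
            simp [w, hx, hxx]
          rw [h2]; push_cast
          apply le_of_eq; field_simp; norm_num
      · intro y hy S hS
        simp only [HF, Finset.mem_union, Finset.mem_image, Finset.mem_filter, Finset.mem_univ,
          true_and] at hy
        rcases hy with ⟨a, ha, rfl⟩ | ⟨a, ha, rfl⟩
        · exact key S hS x hx a ha
        · rw [← key S hS x⁻¹ (by simpa using hx) a ha]
          nth_rewrite 1 [← hS.1]; simp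
  · intro x
    simp only [w]
    have : (0:ℝ) ≤ 1/(2*(p:ℝ)) := by positivity
    split_ifs <;> linarith
  · apply Real.rpow_le_rpow_of_exponent_le (by norm_num)
    set k := (Finset.univ.filter (fun x : A => x ∈ K)).card with hk
    set k' := (Finset.univ.filter (fun x : A => x ∉ K)).card with hk'
    set mK := (Finset.univ.filter (fun x : A => x ∈ K ∧ x * x = 1)).card with hmK
    set mK' := (Finset.univ.filter (fun x : A => x ∉ K ∧ x * x = 1)).card with hmK'
    set t := (Finset.univ.filter (fun x : A => x ∉ K ∧ x * x ∈ H)).card with ht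
    have hsum : ∑ x, w x = k * (1/2) + mK * (1/2) + k' * (1/(2*(p:ℝ))) + t * (1/(2*(p:ℝ))) := by
      simp only [w, Finset.sum_add_distrib, ← Finset.sum_filter, Finset.sum_const, nsmul_eq_mul]
      rfl
    have hkk : k + k' = Fintype.card A := by
      rw [hk, hk', Finset.card_filter_add_card_filter_not, Finset.card_univ]
    have hm' : m = (Finset.univ.filter (fun x : A => x * x = 1)).card := by
      rw [hm, Nat.card_eq_fintype_card, Fintype.card_subtype]
    have hmm : mK + mK' = m := by
      rw [hm', ← Finset.card_filter_add_card_filter_not (s := Finset.univ.filter (fun x : A => x * x = 1)) (fun x => x ∈ K),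
        Finset.filter_filter, Finset.filter_filter, hmK, hmK']
      simp only [and_comm]
    have hk2 : 2 * k ≤ Fintype.card A := by
      have h1 : k = Nat.card K := by
        rw [hk, Nat.card_eq_fintype_card, Fintype.card_subtype]
      have hi := K.card_mul_index
      rw [Nat.card_eq_fintype_card (α := A), ← h1] at hi
      have h0 : K.index ≠ 0 := K.index_ne_zero_of_finite
      have h1 : K.index ≠ 1 := fun h => hK (Subgroup.index_eq_one.mp h)
      have : 2 ≤ K.index := by omega
      nlinarith
    have htsum : t = ∑ h ∈ HF, (Finset.univ.filter (fun x : A => x ∉ K ∧ x * x = h)).card := by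
      rw [ht, Finset.card_eq_sum_card_fiberwise (f := fun x => x * x) (t := HF)]
      · apply Finset.sum_congr rfl
        intro h hh
        congr 1
        ext x
        simp only [HF, Finset.mem_filter, Finset.mem_univ, true_and] at hh ⊢
        constructor
        · rintro ⟨⟨a, b⟩, c⟩; exact ⟨a, c⟩
        · rintro ⟨a, c⟩; exact ⟨⟨a, c ▸ hh⟩, c⟩
      · intro x hx
        simp only [HF, Finset.coe_filter, Finset.mem_univ, true_and, Set.mem_ofPred_eq] at hx ⊢
        exact hx.2
    rw [hsum]
    have hkkR : (k:ℝ) + k' = Fintype.card A := by exact_mod_cast hkk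
    have hmmR : (mK:ℝ) + mK' = m := by exact_mod_cast hmm
    have hk2R : 2 * (k:ℝ) ≤ Fintype.card A := by exact_mod_cast hk2
    have hmnR : 3 * (m:ℝ) ≤ Fintype.card A := by exact_mod_cast hmn
    have hk'0 : (0:ℝ) ≤ k' := by positivity
    have hmK'0 : (0:ℝ) ≤ mK' := by positivity
    rcases hH with h2 | ⟨hodd, h3⟩
    · -- order two
      have hb : ∀ h : A, (Finset.univ.filter (fun x : A => x ∉ K ∧ x * x = h)).card ≤ m := by
        intro h
        rcases (Finset.univ.filter (fun x : A => x ∉ K ∧ x * x = h)).eq_empty_or_nonempty with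
          he | ⟨x0, hx0⟩
        · rw [he]; simp
        · rw [hm']
          simp only [Finset.mem_filter, Finset.mem_univ, true_and] at hx0
          apply Finset.card_le_card_of_injOn (fun x => x * x0⁻¹)
          · intro x hx
            simp only [Finset.coe_filter, Finset.mem_univ, true_and, Set.mem_ofPred_eq] at hx ⊢
            rw [mul_mul_mul_comm, hx.2, ← mul_inv, hx0.2]; simp
          · exact (mul_left_injective x0⁻¹).injOn
      have ht2 : t ≤ mK' + m := by
        have h1 : (1:A) ∈ HF := by simp [HF, H.one_mem]
        rw [htsum, ← Finset.add_sum_erase _ _ h1]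
        have := Finset.sum_le_card_nsmul (HF.erase 1)
          (fun h => (Finset.univ.filter (fun x : A => x ∉ K ∧ x * x = h)).card) m
          (fun h _ => hb h)
        rw [Finset.card_erase_of_mem h1, hHF, h2] at this
        simp only [Nat.add_one_sub_one, smul_eq_mul, one_mul] at this
        omega
      have ht2R : (t:ℝ) ≤ mK' + m := by exact_mod_cast ht2
      have hpR : (p:ℝ) = 2 := by exact_mod_cast h2
      rw [hpR]
      linarith
    · have hb : ∀ h ∈ HF, (Finset.univ.filter (fun x : A => x ∉ K ∧ x * x = h)).card ≤ mK' := by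
        intro h hh
        simp only [HF, Finset.mem_filter, Finset.mem_univ, true_and] at hh
        obtain ⟨j, hj⟩ := hodd
        have hg : h ^ (j+1) ∈ H := H.pow_mem hh _
        have hgg : h ^ (j+1) * h ^ (j+1) = h := by
          have : h ^ p = 1 := by
            have := pow_card_eq_one' (x := (⟨h, hh⟩ : H))
            exact congrArg Subtype.val this
          rw [← pow_add, show j + 1 + (j+1) = p + 1 by omega, pow_succ, this, one_mul]
        apply Finset.card_le_card_of_injOn (fun x => x * (h^(j+1))⁻¹)
        · intro x hx
          simp only [Finset.coe_filter, Finset.mem_univ, true_and, Set.mem_ofPred_eq] at hx ⊢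
          refine ⟨fun hc => hx.1 ((K.mul_mem_cancel_right (K.inv_mem (hHK hg))).1 hc), ?_⟩
          rw [mul_mul_mul_comm, hx.2, ← mul_inv, hgg]; simp
        · exact (mul_left_injective _).injOn
      have ht2 : t ≤ p * mK' := by
        rw [htsum]
        have := Finset.sum_le_card_nsmul HF _ mK' hb
        rwa [hHF, smul_eq_mul] at this
      have ht2R : (t:ℝ) ≤ p * mK' := by exact_mod_cast ht2
      have h3R : (3:ℝ) ≤ p := by exact_mod_cast h3
      have e1 : (t:ℝ) * (1/(2*(p:ℝ))) ≤ mK' / 2 := by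
        rw [mul_one_div, div_le_iff₀ (by positivity)]
        linarith
      have e2 : (k':ℝ) * (1/(2*(p:ℝ))) ≤ k' / 6 := by
        rw [mul_one_div, div_le_iff₀ (by positivity)]
        nlinarith
      linarith

lemma aux_char {A : Type} [Fintype A] [CommGroup A] (K : Subgroup A) (hK : K ≠ ⊤) :
    ∃ χ : A →* ℂˣ, K ≤ χ.ker ∧ χ.ker ≠ ⊤ := by
  obtain ⟨a, ha⟩ : ∃ a, a ∉ K := by
    by_contra! h
    exact hK ((Subgroup.eq_top_iff' K).2 h)
  have h1 : (QuotientGroup.mk a : A ⧸ K) ≠ 1 := by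
    rwa [Ne, QuotientGroup.eq_one_iff]
  obtain ⟨φ, hφ⟩ := CommGroup.exists_apply_ne_one_of_hasEnoughRootsOfUnity (A ⧸ K) ℂ h1
  refine ⟨φ.comp (QuotientGroup.mk' K), ?_, ?_⟩
  · intro x hx
    rw [MonoidHom.mem_ker, MonoidHom.comp_apply, QuotientGroup.mk'_apply,
      (QuotientGroup.eq_one_iff x).2 hx, map_one]
  · intro h
    apply hφ
    have : a ∈ (φ.comp (QuotientGroup.mk' K)).ker := by rw [h]; trivial
    exact this

open Classical in
theorem aux_main
    (n : ℕ) (hn2 : ∀ k : ℕ, n ≠ 2 ^ k)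
    (A : Type) [Fintype A] [CommGroup A] (hn : n = Fintype.card A)
    (m : ℕ) (hm : m = Nat.card {a : A // a * a = 1}) :
    (Nat.card {S : Set A // S⁻¹ = S ∧ ∃ H K : Subgroup A, H ≠ ⊥ ∧ H ≤ K ∧ K ≠ ⊤ ∧
        ∀ x ∈ S, x ∉ K → ∀ h ∈ H, x * h ∈ S} : ℝ) ≤
      2 ^ ((m : ℝ) / 2 + 11 * n / 24 + 2 * (Real.logb 2 n) ^ 2) := by
  have hmn : 3 * m ≤ Fintype.card A := by
    rw [hm, ← hn]; exact aux_m_le n hn2 A hn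
  obtain ⟨e⟩ := CommGroup.monoidHom_mulEquiv_of_hasEnoughRootsOfUnity A ℂ
  haveI : Fintype (A →* ℂˣ) := Fintype.ofEquiv A e.symm.toEquiv
  have hcard : Fintype.card (A →* ℂˣ) = n := by
    rw [hn]; exact Fintype.card_congr e.toEquiv
  let G : A × (A →* ℂˣ) → Finset (Set A) := fun q => Finset.univ.filter (fun S =>
    (q.1 ∈ q.2.ker ∧ q.2.ker ≠ ⊤ ∧ (orderOf q.1).Prime) ∧ S⁻¹ = S ∧
      ∀ x ∈ S, x ∉ q.2.ker → ∀ h ∈ Subgroup.zpowers q.1, x * h ∈ S)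
  have hG : ∀ q, ((G q).card : ℝ) ≤ 2 ^ ((m : ℝ) / 2 + 11 * n / 24) := by
    rintro ⟨z, χ⟩
    by_cases hq : z ∈ χ.ker ∧ χ.ker ≠ ⊤ ∧ (orderOf z).Prime
    · have := aux_pair (Subgroup.zpowers z) χ.ker (by simpa using hq.1) hq.2.1 (by
        rw [Nat.card_zpowers]
        rcases hq.2.2.eq_two_or_odd' with h | h
        · exact Or.inl h
        · refine Or.inr ⟨h, ?_⟩
          have := hq.2.2.two_le
          obtain ⟨j, hj⟩ := h
          omega) m hm hmn
      rw [← hn] at this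
      refine le_trans ?_ this
      norm_cast
      apply Finset.card_le_card
      intro S hS
      simp only [G, Finset.mem_filter, Finset.mem_univ, true_and] at hS ⊢
      exact hS.2
    · have : G (z, χ) = ∅ := by
        apply Finset.filter_eq_empty_iff.mpr
        intro S _ h
        exact hq h.1
      rw [this]
      simp only [Finset.card_empty, Nat.cast_zero]
      positivity
  rw [Nat.card_eq_fintype_card, Fintype.card_subtype]
  have hsub : (Finset.univ.filter (fun S : Set A => S⁻¹ = S ∧ ∃ H K : Subgroup A, H ≠ ⊥ ∧ H ≤ K ∧ K ≠ ⊤ ∧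
        ∀ x ∈ S, x ∉ K → ∀ h ∈ H, x * h ∈ S)) ⊆ Finset.univ.biUnion G := by
    intro S hS
    simp only [Finset.mem_filter, Finset.mem_univ, true_and] at hS
    obtain ⟨hS, H, K, hH, hHK, hK, h⟩ := hS
    obtain ⟨χ, hχ, hχ'⟩ := aux_char K hK
    have hc : Nat.card H ≠ 1 := fun hc => hH (Subgroup.eq_bot_of_card_eq H hc)
    obtain ⟨p, hp, hpd⟩ := Nat.exists_prime_and_dvd hc
    haveI := Fact.mk hp
    obtain ⟨⟨z, hz⟩, hzo⟩ := exists_prime_orderOf_dvd_card' (G := H) p hpd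
    rw [Subgroup.orderOf_mk] at hzo
    rw [Finset.mem_biUnion]
    refine ⟨(z, χ), Finset.mem_univ _, ?_⟩
    simp only [G, Finset.mem_filter, Finset.mem_univ, true_and]
    refine ⟨⟨hχ (hHK hz), hχ', hzo ▸ hp⟩, hS, ?_⟩
    intro x hx hxK y hy
    exact h x hx (fun hc => hxK (hχ hc)) y ((Subgroup.zpowers_le.mpr hz) hy)
  have h1 : ((Finset.univ.biUnion G).card : ℝ) ≤ (n * n : ℝ) * 2 ^ ((m : ℝ) / 2 + 11 * n / 24) := by
    calc ((Finset.univ.biUnion G).card : ℝ) ≤ ∑ q, ((G q).card : ℝ) := by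
          exact_mod_cast Finset.card_biUnion_le
      _ ≤ ∑ q : A × (A →* ℂˣ), (2:ℝ) ^ ((m : ℝ) / 2 + 11 * n / 24) :=
          Finset.sum_le_sum (fun q _ => hG q)
      _ = _ := by
          rw [Finset.sum_const, Finset.card_univ, Fintype.card_prod, hcard, ← hn, nsmul_eq_mul]
          push_cast; rfl
  have hn0 : 0 < n := by rw [hn]; exact Fintype.card_pos
  have hn1 : n ≠ 1 := hn2 0
  have hnR : (2:ℝ) ≤ n := by exact_mod_cast (show 2 ≤ n by omega)
  have hnR0 : (0:ℝ) < n := by linarith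
  have hL : 1 ≤ Real.logb 2 n := by
    rw [Real.le_logb_iff_rpow_le (by norm_num) hnR0]; simpa using hnR
  have hnn : (n * n : ℝ) ≤ 2 ^ (2 * (Real.logb 2 n) ^ 2) := by
    have : (n * n : ℝ) = 2 ^ (Real.logb 2 n + Real.logb 2 n) := by
      rw [Real.rpow_add (by norm_num), Real.rpow_logb (by norm_num) (by norm_num) hnR0]
    rw [this]
    apply Real.rpow_le_rpow_of_exponent_le (by norm_num)
    nlinarith
  calc _ ≤ ((Finset.univ.biUnion G).card : ℝ) := by exact_mod_cast Finset.card_le_card hsub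
    _ ≤ _ := h1
    _ ≤ 2 ^ (2 * (Real.logb 2 n) ^ 2) * 2 ^ ((m : ℝ) / 2 + 11 * n / 24) := by gcongr
    _ = _ := by rw [← Real.rpow_add (by norm_num), add_comm]

theorem count_inverse_closed_generalized_wreath_subsets
    (n : ℕ) (hn2 : ∀ k : ℕ, n ≠ 2 ^ k)
    (A : Type) [Fintype A] [CommGroup A] (hn : n = Fintype.card A)
    (m : ℕ) (hm : m = Nat.card {a : A // a * a = 1}) :
    (Nat.card {S : Set A // S⁻¹ = S ∧ ∃ H K : Subgroup A, H ≠ ⊥ ∧ H ≤ K ∧ K ≠ ⊤ ∧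
        ∀ x ∈ S, x ∉ K → ∀ h ∈ H, x * h ∈ S} : ℝ) ≤
      2 ^ ((m : ℝ) / 2 + 11 * n / 24 + 2 * (Real.logb 2 n) ^ 2) :=
  aux_main n hn2 A hn m hm
end

section
/- Let A be an abelian group of order n and of exponent greater than 2, let m be the number of elements of order at most 2 in A, and let ι : A → A be the automorphism defined by ι(x) = x⁻¹. Then the number of inverse-closed subsets of A that are invariant under some automorphism of A other than the identity and ι is at most 2^{m/2 + 11n/24 + (log₂ n)²}. -/
open scoped Pointwise

theorem aux_exists_gen (A : Type) [Fintype A] [CommGroup A] :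
    ∃ S : Finset A, Subgroup.closure (S : Set A) = ⊤ ∧ 2 ^ S.card ≤ Fintype.card A := by
  classical
  obtain ⟨S, hS, hmax⟩ := Finset.exists_max_image
    (Finset.univ.filter fun S : Finset A => 2 ^ S.card ≤ Nat.card (Subgroup.closure (S : Set A)))
    (fun S => Nat.card (Subgroup.closure (S : Set A))) ⟨∅, by simp⟩
  simp only [Finset.mem_filter, Finset.mem_univ, true_and] at hS hmax
  have htop : Subgroup.closure (S : Set A) = ⊤ := by
    by_contra hne
    obtain ⟨x, hx⟩ : ∃ x, x ∉ Subgroup.closure (S : Set A) := by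
      by_contra! h
      exact hne ((Subgroup.eq_top_iff' _).2 h)
    have hle : Subgroup.closure (S : Set A) ≤ Subgroup.closure ((insert x S : Finset A) : Set A) :=
      Subgroup.closure_mono (by simp)
    have hxm : x ∈ Subgroup.closure ((insert x S : Finset A) : Set A) :=
      Subgroup.subset_closure (by simp)
    obtain ⟨k, hk⟩ := Subgroup.card_dvd_of_le hle
    have hpos : 0 < Nat.card (Subgroup.closure ((insert x S : Finset A) : Set A)) := Nat.card_pos
    have hpos' : 0 < Nat.card (Subgroup.closure (S : Set A)) := Nat.card_pos
    have hk2 : 2 ≤ k := by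
      by_contra hlt
      have : k = 0 ∨ k = 1 := by omega
      rcases this with rfl | rfl
      · simp at hk
      · have := Subgroup.eq_of_le_of_card_ge hle (by omega)
        rw [← this] at hxm
        exact hx hxm
    have h2 : 2 * Nat.card (Subgroup.closure (S : Set A)) ≤
        Nat.card (Subgroup.closure ((insert x S : Finset A) : Set A)) := by
      rw [hk]; nlinarith
    have h3 : 2 ^ (insert x S).card ≤ 
        Nat.card (Subgroup.closure ((insert x S : Finset A) : Set A)) := by
      calc 2 ^ (insert x S).card ≤ 2 ^ (S.card + 1) :=
            Nat.pow_le_pow_right (by norm_num) (Finset.card_insert_le _ _)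
        _ = 2 * 2 ^ S.card := by ring
        _ ≤ _ := by omega
    have := hmax _ h3
    omega
  refine ⟨S, htop, ?_⟩
  rw [htop] at hS
  simpa using hS

theorem aux_card_aut (A : Type) [Fintype A] [CommGroup A] :
    (Nat.card (A ≃* A) : ℝ) ≤ 2 ^ ((Real.logb 2 (Fintype.card A)) ^ 2 : ℝ) := by
  classical
  obtain ⟨S, hS, hc⟩ := aux_exists_gen A
  have hinj : Function.Injective (fun (φ : A ≃* A) (s : S) => φ s) := by
    intro φ ψ h
    have : φ.toMonoidHom = ψ.toMonoidHom := by
      apply MonoidHom.eq_of_eqOn_dense hS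
      intro x hx
      exact congrFun h ⟨x, hx⟩
    ext x
    exact DFunLike.congr_fun this x
  have h1 : Nat.card (A ≃* A) ≤ Fintype.card A ^ S.card := by
    have := Nat.card_le_card_of_injective _ hinj
    simpa using this
  have hn : (0 : ℝ) < Fintype.card A := by exact_mod_cast Fintype.card_pos
  have hlog : (S.card : ℝ) ≤ Real.logb 2 (Fintype.card A) := by
    rw [Real.le_logb_iff_rpow_le (by norm_num) hn, Real.rpow_natCast]
    exact_mod_cast hc
  calc (Nat.card (A ≃* A) : ℝ) ≤ (Fintype.card A : ℝ) ^ S.card := by exact_mod_cast h1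
    _ = (2 ^ (Real.logb 2 (Fintype.card A)) : ℝ) ^ S.card := by
        rw [Real.rpow_logb (by norm_num) (by norm_num) hn]
    _ = 2 ^ (Real.logb 2 (Fintype.card A) * S.card) := by
        rw [Real.rpow_mul (by norm_num), Real.rpow_natCast]
    _ ≤ _ := by
        apply Real.rpow_le_rpow_of_exponent_le (by norm_num)
        rw [sq]
        exact mul_le_mul_of_nonneg_left hlog (le_trans (Nat.cast_nonneg _) hlog)

/-- The relation of not being separated by a family of sets. -/
def auxSetoid {A : Type} (P : Set A → Prop) : Setoid A where
  r x y := ∀ S, P S → (x ∈ S ↔ y ∈ S)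
  iseqv := ⟨fun _ _ _ => Iff.rfl, fun h S hS => (h S hS).symm,
    fun h h' S hS => (h S hS).trans (h' S hS)⟩

theorem aux_card_quot_s14 {A : Type} [Fintype A] (P : Set A → Prop) :
    Nat.card {S : Set A // P S} ≤ 2 ^ Nat.card (Quotient (auxSetoid P)) := by
  classical
  have hinj : Function.Injective (fun (S : {S : Set A // P S}) =>
      (Set.image (Quotient.mk (auxSetoid P)) S.1 : Set (Quotient (auxSetoid P)))) := by
    have key : ∀ S T : {S : Set A // P S}, Set.image (Quotient.mk (auxSetoid P)) S.1 =
        Set.image (Quotient.mk (auxSetoid P)) T.1 → S.1 ⊆ T.1 := by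
      intro S T h x hx
      have : Quotient.mk (auxSetoid P) x ∈ Set.image (Quotient.mk (auxSetoid P)) T.1 := by
        rw [← h]; exact ⟨x, hx, rfl⟩
      obtain ⟨y, hy, hxy⟩ := this
      exact ((Quotient.exact hxy) T.1 T.2).1 hy
    intro S T h
    exact Subtype.ext (Set.Subset.antisymm (key S T h) (key T S h.symm))
  have h := Nat.card_le_card_of_injective _ hinj
  have : Fintype (Quotient (auxSetoid P)) := Fintype.ofFinite _
  rw [Nat.card_eq_fintype_card (α := Set _), Fintype.card_set] at h
  rwa [Nat.card_eq_fintype_card (α := Quotient _)]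

theorem aux_quot_sum {A : Type} [Fintype A] (s : Setoid A) (w : A → ℝ)
    (hw : ∀ x, ∃ F : Finset A, (∀ y ∈ F, s x y) ∧ 1 ≤ w x * F.card ∧ 0 ≤ w x) :
    (Nat.card (Quotient s) : ℝ) ≤ ∑ x, w x := by
  classical
  have : Fintype (Quotient s) := Fintype.ofFinite _
  rw [Nat.card_eq_fintype_card,
    ← Finset.sum_fiberwise (s := Finset.univ) (g := fun x => Quotient.mk s x) (f := w)]
  rw [← Finset.card_univ, Finset.card_eq_sum_ones, Nat.cast_sum]
  apply Finset.sum_le_sum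
  intro q _
  set C := Finset.univ.filter (fun x => Quotient.mk s x = q) with hC
  have hCpos : 0 < C.card := by
    obtain ⟨x, rfl⟩ := Quotient.exists_rep q
    exact Finset.card_pos.2 ⟨x, by simp [hC]⟩
  have hc : (0:ℝ) < C.card := by exact_mod_cast hCpos
  have hb : ∀ x ∈ C, (1:ℝ) / C.card ≤ w x := by
    intro x hx
    obtain ⟨F, hF, h1, h0⟩ := hw x
    have hsub : F ⊆ C := by
      intro y hy
      simp only [hC, Finset.mem_filter, Finset.mem_univ, true_and] at hx ⊢
      rw [← hx]
      exact (Quotient.sound (hF y hy)).symm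
    have hle : (F.card : ℝ) ≤ C.card := by exact_mod_cast Finset.card_le_card hsub
    rw [div_le_iff₀ hc]
    nlinarith
  have := Finset.sum_le_sum hb
  rw [Finset.sum_const, nsmul_eq_mul, mul_one_div_cancel hc.ne'] at this
  simpa using this

theorem aux_sub_dvd {A : Type} [Fintype A] [CommGroup A] (H : Subgroup A) (h : H ≠ ⊤) :
    2 * Nat.card H = Nat.card A ∨ 3 * Nat.card H ≤ Nat.card A := by
  obtain ⟨k, hk⟩ := Subgroup.card_subgroup_dvd_card H
  have hp : 0 < Nat.card A := Nat.card_pos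
  have h0 : k ≠ 0 := by rintro rfl; simp at hk
  have h1 : k ≠ 1 := by
    rintro rfl
    exact h (Subgroup.eq_top_of_card_eq H (by omega))
  by_cases h2 : k = 2
  · left; subst h2; omega
  · right
    rw [hk]
    have : 3 ≤ k := by omega
    nlinarith

/-- The subgroup fixed by an automorphism. -/
def auxH {A : Type} [CommGroup A] (φ : A ≃* A) : Subgroup A :=
  φ.toMonoidHom.eqLocus (MonoidHom.id A)

/-- The subgroup inverted by an automorphism. -/
def auxK {A : Type} [CommGroup A] (φ : A ≃* A) : Subgroup A :=
  φ.toMonoidHom.eqLocus (MulEquiv.inv A).toMonoidHom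

theorem mem_auxH {A : Type} [CommGroup A] (φ : A ≃* A) (x : A) : x ∈ auxH φ ↔ φ x = x := Iff.rfl

theorem mem_auxK {A : Type} [CommGroup A] (φ : A ≃* A) (x : A) : x ∈ auxK φ ↔ φ x = x⁻¹ := Iff.rfl

theorem aux_HK {A : Type} [Fintype A] [CommGroup A] (φ : A ≃* A) (h1 : φ ≠ MulEquiv.refl A)
    (h2 : φ ≠ MulEquiv.inv A) :
    6 * (Nat.card (auxH φ) + Nat.card (auxK φ)) ≤
      6 * Nat.card {a : A // a * a = 1} + 5 * Nat.card A := by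
  have hH : auxH φ ≠ ⊤ := by
    intro h
    apply h1
    ext x
    exact (mem_auxH φ x).1 (h ▸ Subgroup.mem_top x)
  have hK : auxK φ ≠ ⊤ := by
    intro h
    apply h2
    ext x
    exact (mem_auxK φ x).1 (h ▸ Subgroup.mem_top x)
  have hI : Nat.card (auxH φ ⊓ auxK φ : Subgroup A) ≤ Nat.card {a : A // a * a = 1} := by
    refine Nat.card_le_card_of_injective
      (fun x => ⟨x.1, ?_⟩ : (auxH φ ⊓ auxK φ : Subgroup A) → {a : A // a * a = 1}) ?_
    · have hx1 := (mem_auxH φ _).1 x.2.1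
      have hx2 := (mem_auxK φ _).1 x.2.2
      rw [hx1] at hx2
      nth_rewrite 1 [hx2]
      simp
    · intro x y h
      exact Subtype.ext (by simpa using h)
  have hidx := Subgroup.index_inf_le (H := auxH φ) (K := auxK φ)
  have eI := Subgroup.card_mul_index (auxH φ ⊓ auxK φ : Subgroup A)
  have eH := Subgroup.card_mul_index (auxH φ)
  have eK := Subgroup.card_mul_index (auxK φ)
  have hp : 0 < Nat.card A := Nat.card_pos
  have pH : 0 < Nat.card (auxH φ) := Nat.card_pos
  have pK : 0 < Nat.card (auxK φ) := Nat.card_pos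
  rcases aux_sub_dvd _ hH with a | a <;> rcases aux_sub_dvd _ hK with b | b
  · have iH : (auxH φ).index = 2 := Nat.eq_of_mul_eq_mul_left pH (by omega)
    have iK : (auxK φ).index = 2 := Nat.eq_of_mul_eq_mul_left pK (by omega)
    rw [iH, iK] at hidx
    have : Nat.card A ≤ 4 * Nat.card {a : A // a * a = 1} := by nlinarith
    omega
  all_goals omega

/-- The family of sets invariant under inversion and under an automorphism. -/
def auxP {A : Type} [CommGroup A] (φ : A ≃* A) (S : Set A) : Prop :=
  S⁻¹ = S ∧ ∀ x : A, x ∈ S ↔ φ x ∈ S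

theorem aux_orbits {A : Type} [Fintype A] [CommGroup A] (φ : A ≃* A) (h1 : φ ≠ MulEquiv.refl A)
    (h2 : φ ≠ MulEquiv.inv A) :
    (Nat.card (Quotient (auxSetoid (auxP φ))) : ℝ) ≤
      (Nat.card {a : A // a * a = 1} : ℝ) / 2 + 11 * (Fintype.card A) / 24 := by
  classical
  have hinv : ∀ x, auxSetoid (auxP φ) x x⁻¹ := by
    intro x S hS
    conv_lhs => rw [← hS.1]
    exact Set.mem_inv
  have hphi : ∀ x, auxSetoid (auxP φ) x (φ x) := fun x S hS => hS.2 x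
  have hphi' : ∀ x, auxSetoid (auxP φ) x (φ x)⁻¹ := fun x =>
    (auxSetoid (auxP φ)).trans (hphi x) (hinv _)
  have hrefl : ∀ x, auxSetoid (auxP φ) x x := fun x => (auxSetoid (auxP φ)).refl x
  have key := aux_quot_sum (auxSetoid (auxP φ))
    (fun x => (1 + (if x * x = 1 then 1 else 0) + (if φ x = x then 1 else 0) +
      (if φ x = x⁻¹ then 1 else 0)) / 4) (by
    intro x
    have hpos : (0:ℝ) ≤ (1 + (if x * x = 1 then 1 else 0) + (if φ x = x then 1 else 0) +
      (if φ x = x⁻¹ then 1 else 0)) / 4 := by positivity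
    have hxx : x * x = 1 ↔ x = x⁻¹ := mul_eq_one_iff_eq_inv
    by_cases a : x * x = 1
    · have a' := hxx.1 a
      by_cases b : φ x = x
      · refine ⟨{x}, by simp, ?_, hpos⟩
        have c : φ x = x⁻¹ := b.trans a'
        rw [if_pos a, if_pos b, if_pos c]
        simp; norm_num
      · refine ⟨{x, φ x}, by simp [hphi], ?_, hpos⟩
        have c : φ x ≠ x⁻¹ := fun h => b (h.trans a'.symm)
        rw [if_pos a, if_neg b, if_neg c, Finset.card_pair (Ne.symm b)]
        norm_num
    · have a' : x ≠ x⁻¹ := fun h => a (hxx.2 h)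
      by_cases b : φ x = x
      · refine ⟨{x, x⁻¹}, by simp [hinv], ?_, hpos⟩
        rw [if_neg a, if_pos b, Finset.card_pair a']
        split_ifs <;> norm_num
      · by_cases c : φ x = x⁻¹
        · refine ⟨{x, x⁻¹}, by simp [hinv], ?_, hpos⟩
          rw [if_neg a, if_neg b, if_pos c, Finset.card_pair a']
          norm_num
        · refine ⟨{x, x⁻¹, φ x, (φ x)⁻¹},
            by simp [hinv, hphi, hphi'], ?_, hpos⟩
          have d : φ x ≠ (φ x)⁻¹ := by
            intro h
            rw [← map_inv] at h
            exact a' (φ.injective h)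
          have e : x ≠ (φ x)⁻¹ := fun h => c (by rw [h, inv_inv, ← h])
          have f : x⁻¹ ≠ (φ x)⁻¹ := fun h => b (inv_injective h).symm
          have hcard : ({x, x⁻¹, φ x, (φ x)⁻¹} : Finset A).card = 4 := by
            rw [Finset.card_insert_of_notMem, Finset.card_insert_of_notMem, Finset.card_pair d]
            · simp only [Finset.mem_insert, Finset.mem_singleton, not_or]
              exact ⟨Ne.symm c, f⟩
            · simp only [Finset.mem_insert, Finset.mem_singleton, not_or]
              exact ⟨a', Ne.symm b, e⟩
          rw [hcard]
          rw [if_neg a, if_neg b, if_neg c]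
          norm_num)
  have hsum : ∀ p : A → Prop, ∀ [DecidablePred p],
      (∑ x, if p x then (1:ℝ) else 0) = Nat.card {a : A // p a} := by
    intro p _
    rw [Finset.sum_boole, Nat.card_eq_fintype_card, Fintype.card_subtype]
  rw [← Finset.sum_div, Finset.sum_add_distrib, Finset.sum_add_distrib, Finset.sum_add_distrib,
    hsum, hsum, hsum] at key
  have hHK := aux_HK φ h1 h2
  have eH : Nat.card {a : A // φ a = a} = Nat.card (auxH φ) := rfl
  have eK : Nat.card {a : A // φ a = a⁻¹} = Nat.card (auxK φ) := rfl
  have hHK' : (6:ℝ) * (Nat.card (auxH φ) + Nat.card (auxK φ)) ≤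
      6 * Nat.card {a : A // a * a = 1} + 5 * Nat.card A := by exact_mod_cast hHK
  rw [eH, eK] at key
  simp only [Finset.sum_const, Finset.card_univ, nsmul_eq_mul, mul_one] at key
  rw [Nat.card_eq_fintype_card (α := A)] at hHK'
  linarith

theorem count_inverse_closed_subsets_invariant_under_exceptional_automorphism
    (A : Type) [Fintype A] [CommGroup A] (n m : ℕ)
    (hn : n = Fintype.card A)
    -- `A` has exponent greater than 2
    (hexp : 2 < Monoid.exponent A)
    (hm : m = Nat.card {a : A // a * a = 1}) :
    (Nat.card {S : Set A // S⁻¹ = S ∧ ∃ φ : A ≃* A, φ ≠ MulEquiv.refl A ∧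
        φ ≠ MulEquiv.inv A ∧ ∀ x : A, x ∈ S ↔ φ x ∈ S} : ℝ) ≤
      2 ^ ((m : ℝ) / 2 + 11 * n / 24 + (Real.logb 2 n) ^ 2) := by
  classical
  have : Finite (A ≃* A) := Finite.of_injective (fun φ => (φ : A → A)) DFunLike.coe_injective
  have : Fintype (A ≃* A) := Fintype.ofFinite _
  subst hn hm
  set X := {φ : A ≃* A // φ ≠ MulEquiv.refl A ∧ φ ≠ MulEquiv.inv A}
  have hle : Nat.card {S : Set A // S⁻¹ = S ∧ ∃ φ : A ≃* A, φ ≠ MulEquiv.refl A ∧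
        φ ≠ MulEquiv.inv A ∧ ∀ x : A, x ∈ S ↔ φ x ∈ S} ≤
      Nat.card (Σ φ : X, {S : Set A // auxP φ.1 S}) := by
    refine Nat.card_le_card_of_surjective (fun p => ⟨p.2.1, p.2.2.1, p.1.1, p.1.2.1, p.1.2.2, p.2.2.2⟩) ?_
    rintro ⟨S, hS, φ, h1, h2, h3⟩
    exact ⟨⟨⟨φ, h1, h2⟩, ⟨S, hS, h3⟩⟩, rfl⟩
  rw [Nat.card_sigma] at hle
  have hX : (Nat.card X : ℝ) ≤ 2 ^ ((Real.logb 2 (Fintype.card A)) ^ 2 : ℝ) := by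
    refine le_trans ?_ (aux_card_aut A)
    exact_mod_cast Nat.card_le_card_of_injective _ (Subtype.val_injective (p := fun φ : A ≃* A =>
      φ ≠ MulEquiv.refl A ∧ φ ≠ MulEquiv.inv A))
  have hb : ∀ φ : X, (Nat.card {S : Set A // auxP φ.1 S} : ℝ) ≤
      2 ^ ((Nat.card {a : A // a * a = 1} : ℝ) / 2 + 11 * (Fintype.card A) / 24) := by
    intro φ
    calc (Nat.card {S : Set A // auxP φ.1 S} : ℝ)
        ≤ 2 ^ Nat.card (Quotient (auxSetoid (auxP φ.1))) := by
          exact_mod_cast aux_card_quot_s14 (auxP φ.1)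
      _ = (2:ℝ) ^ (Nat.card (Quotient (auxSetoid (auxP φ.1))) : ℝ) := (Real.rpow_natCast _ _).symm
      _ ≤ _ := Real.rpow_le_rpow_of_exponent_le (by norm_num) (aux_orbits φ.1 φ.2.1 φ.2.2)
  refine le_trans (Nat.cast_le.2 hle) ?_
  rw [Nat.cast_sum]
  refine le_trans (Finset.sum_le_sum fun φ _ => hb φ) ?_
  rw [Finset.sum_const, nsmul_eq_mul, Finset.card_univ, ← Nat.card_eq_fintype_card]
  refine le_trans (mul_le_mul_of_nonneg_right hX (by positivity)) (le_of_eq ?_)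
  rw [mul_comm, ← Real.rpow_add (by norm_num)]
end

section
/- Let A be an abelian group of order n and of exponent greater than 2, let m be the number of elements of order at most 2 in A, let ι be the automorphism x ↦ x⁻¹, and let φ be an automorphism of A with φ ∉ {1, ι}. Then the number of inverse-closed subsets of A that are invariant under φ is at most 2^{m/2 + 11n/24}. -/
open scoped Pointwise

/-- Number of classes of a setoid as a sum of reciprocals of class sizes, bounded by weights. -/
lemma card_quotient_le_sum {A Q : Type} [Fintype A] [Fintype Q] [DecidableEq Q] (f : A → Q)
    (hf : Function.Surjective f) (w : A → ℝ)
    (hw : ∀ x, 1 ≤ w x * ((Finset.univ.filter (fun y => f y = f x)).card : ℝ)) :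
    (Fintype.card Q : ℝ) ≤ ∑ x, w x := by
  rw [← Finset.sum_fiberwise Finset.univ f w]
  have h1 : (Fintype.card Q : ℝ) = ∑ _q : Q, (1 : ℝ) := by simp
  rw [h1]
  refine Finset.sum_le_sum fun q _ => ?_
  obtain ⟨x0, rfl⟩ := hf q
  set s := Finset.univ.filter (fun y => f y = f x0) with hs
  have hpos : 0 < (s.card : ℝ) := by
    have : 0 < s.card := Finset.card_pos.mpr ⟨x0, by simp [hs]⟩
    exact_mod_cast this
  have h2 : ∑ x ∈ s, (1 / (s.card : ℝ)) ≤ ∑ x ∈ s, w x := by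
    refine Finset.sum_le_sum fun y hy => ?_
    have hy' : f y = f x0 := by simpa [hs] using hy
    have := hw y
    rw [hy'] at this
    rw [div_le_iff₀ hpos]
    exact this
  have h3 : ∑ x ∈ s, (1 / (s.card : ℝ)) = 1 := by
    rw [Finset.sum_const, nsmul_eq_mul]
    field_simp
  linarith

/-- The arithmetic of fixed-point and inverted-point subgroups. -/
lemma card_fix_add_card_inv {A : Type} [Fintype A] [CommGroup A] (C D : Subgroup A)
    (hC : C ≠ ⊤) (hD : D ≠ ⊤) (m : ℕ) (hk : Nat.card (C ⊓ D : Subgroup A) ≤ m) :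
    6 * (Nat.card C + Nat.card D) ≤ 6 * m + 5 * Nat.card A := by
  have i0 := C.index_ne_zero_of_finite
  have j0 := D.index_ne_zero_of_finite
  have i1 : C.index ≠ 1 := fun h => hC (Subgroup.index_eq_one.mp h)
  have j1 : D.index ≠ 1 := fun h => hD (Subgroup.index_eq_one.mp h)
  have hc := C.card_mul_index
  have hd := D.card_mul_index
  have hkk := (C ⊓ D).card_mul_index
  have hle := Subgroup.index_inf_le (H := C) (K := D)
  generalize Nat.card C = c at *
  generalize Nat.card D = d at *
  generalize Nat.card (C ⊓ D : Subgroup A) = k at *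
  generalize Nat.card A = n at *
  generalize (C ⊓ D).index = l at *
  generalize C.index = i at *
  generalize D.index = j at *
  have hi : 2 ≤ i := by omega
  have hj : 2 ≤ j := by omega
  have c2 : c * 2 ≤ n := hc ▸ Nat.mul_le_mul_left c hi
  have d2 : d * 2 ≤ n := hd ▸ Nat.mul_le_mul_left d hj
  by_cases hi3 : 3 ≤ i
  · have : c * 3 ≤ n := hc ▸ Nat.mul_le_mul_left c hi3
    omega
  by_cases hj3 : 3 ≤ j
  · have : d * 3 ≤ n := hd ▸ Nat.mul_le_mul_left d hj3
    omega
  have ei : i = 2 := by omega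
  have ej : j = 2 := by omega
  subst ei ej
  have : n ≤ k * 4 := hkk ▸ Nat.mul_le_mul_left k hle
  omega

theorem count_inverse_closed_subsets_invariant_under_fixed_automorphism
    (A : Type) [Fintype A] [CommGroup A] (n m : ℕ)
    (hn : n = Fintype.card A)
    -- `A` has exponent greater than 2
    (hexp : 2 < Monoid.exponent A)
    (hm : m = Nat.card {a : A // a * a = 1})
    (φ : A ≃* A) (hφ1 : φ ≠ MulEquiv.refl A) (hφι : φ ≠ MulEquiv.inv A) :
    (Nat.card {S : Set A // S⁻¹ = S ∧ ∀ x : A, x ∈ S ↔ φ x ∈ S} : ℝ) ≤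
      2 ^ ((m : ℝ) / 2 + 11 * n / 24) := by
  classical
  let P : Set A → Prop := fun S => S⁻¹ = S ∧ ∀ x : A, x ∈ S ↔ φ x ∈ S
  let r : Setoid A :=
    { r := fun x y => ∀ S, P S → (x ∈ S ↔ y ∈ S)
      iseqv := ⟨fun _ _ _ => Iff.rfl, fun h S hS => (h S hS).symm,
        fun h h' S hS => (h S hS).trans (h' S hS)⟩ }
  let Q := Quotient r
  let f : A → Q := Quotient.mk r
  have hinv : ∀ x, f x⁻¹ = f x := fun x => Quotient.sound (s := r) fun S hS => by
    conv_rhs => rw [← hS.1]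
    exact Set.mem_inv.symm
  have hphi : ∀ x, f (φ x) = f x := fun x => Quotient.sound (s := r) fun S hS =>
    (hS.2 x).symm
  -- invariant sets inject into sets of classes
  have hcard : Nat.card {S : Set A // P S} ≤ 2 ^ Fintype.card Q := by
    have : Nat.card (Set Q) = 2 ^ Fintype.card Q := by
      rw [Nat.card_eq_fintype_card, Fintype.card_set]
    rw [← this]
    refine Nat.card_le_card_of_injective (fun S => f '' S.1) ?_
    have key : ∀ S T : {S : Set A // P S}, f '' S.1 = f '' T.1 → S.1 ⊆ T.1 := by
      intro S T h x hx
      have : f x ∈ f '' T.1 := h ▸ ⟨x, hx, rfl⟩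
      obtain ⟨y, hy, hyx⟩ := this
      exact (Quotient.exact hyx T.1 T.2).mp hy
    intro S T h
    exact Subtype.ext (Set.Subset.antisymm (key S T h) (key T S h.symm))
  let C : Subgroup A := φ.toMonoidHom.eqLocus (MonoidHom.id A)
  let D : Subgroup A := φ.toMonoidHom.eqLocus (MulEquiv.inv A).toMonoidHom
  have memC : ∀ x, x ∈ C ↔ φ x = x := fun x => Iff.rfl
  have memD : ∀ x, x ∈ D ↔ φ x = x⁻¹ := fun x => Iff.rfl
  have hC : C ≠ ⊤ := fun h => hφ1 (MulEquiv.ext fun x =>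
    (memC x).mp (h ▸ Subgroup.mem_top x))
  have hD : D ≠ ⊤ := fun h => hφι (MulEquiv.ext fun x =>
    (memD x).mp (h ▸ Subgroup.mem_top x))
  have hk : Nat.card (C ⊓ D : Subgroup A) ≤ m := by
    rw [hm]
    refine Nat.card_le_card_of_injective
      (fun x : (C ⊓ D : Subgroup A) => (⟨x.1, ?_⟩ : {a : A // a * a = 1})) ?_
    · have h1 := (memC x.1).mp x.2.1
      have h2 := (memD x.1).mp x.2.2
      rw [h1] at h2
      exact mul_eq_one_iff_eq_inv.mpr h2
    · intro x y h
      exact Subtype.ext (congrArg (fun z => z.1) h)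
  have harith := card_fix_add_card_inv C D hC hD m hk
  have hq := card_quotient_le_sum f Quotient.mk_surjective
    (fun x => (1 + (if x * x = 1 then 1 else 0) + (if φ x = x then 1 else 0)
      + (if φ x = x⁻¹ then 1 else 0) : ℝ) / 4) (by
    intro x
    set s := Finset.univ.filter (fun y => f y = f x) with hs
    have ms : ∀ y, y ∈ s ↔ f y = f x := fun y => by simp [hs]
    have a1 : x ∈ s := (ms _).2 rfl
    have a2 : x⁻¹ ∈ s := (ms _).2 (hinv x)
    have a3 : φ x ∈ s := (ms _).2 (hphi x)
    have a4 : (φ x)⁻¹ ∈ s := (ms _).2 ((hinv _).trans (hphi x))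
    have c1 : (1 : ℝ) ≤ s.card := by
      exact_mod_cast Finset.card_pos.mpr ⟨x, a1⟩
    have two : ∀ y ∈ s, x ≠ y → (2 : ℝ) ≤ s.card := fun y hy hxy => by
      have : ({x, y} : Finset A).card ≤ s.card := Finset.card_le_card (by
        intro z hz
        simp only [Finset.mem_insert, Finset.mem_singleton] at hz
        rcases hz with rfl | rfl <;> assumption)
      rw [Finset.card_pair hxy] at this
      exact_mod_cast this
    by_cases hM : x * x = 1
    · have hxi : x = x⁻¹ := mul_eq_one_iff_eq_inv.mp hM
      rw [← hxi]
      by_cases h : φ x = x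
      · simp only [hM, h, if_true]; linarith
      · have := two _ a3 (Ne.symm h)
        simp only [hM, h, if_true, if_false]; linarith
    · have hxi : x ≠ x⁻¹ := fun h => hM (mul_eq_one_iff_eq_inv.mpr h)
      have h2 := two _ a2 hxi
      by_cases h : φ x = x
      · simp only [hM, h, hxi, if_true, if_false]; linarith
      by_cases h' : φ x = x⁻¹
      · simp only [hM, h', hxi.symm, if_true, if_false]; linarith
      have hne : φ x ≠ (φ x)⁻¹ := fun e => hxi (φ.injective (by rw [map_inv]; exact e))
      have h4 : (4 : ℝ) ≤ s.card := by
        have : ({x, x⁻¹, φ x, (φ x)⁻¹} : Finset A).card ≤ s.card := Finset.card_le_card (by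
          intro z hz
          simp only [Finset.mem_insert, Finset.mem_singleton] at hz
          rcases hz with rfl | rfl | rfl | rfl <;> assumption)
        have e : ({x, x⁻¹, φ x, (φ x)⁻¹} : Finset A).card = 4 := by
          have n1 : x ≠ φ x := Ne.symm h
          have n2 : x ≠ (φ x)⁻¹ := fun e => h' (inv_eq_iff_eq_inv.mp e.symm)
          have n3 : x⁻¹ ≠ φ x := Ne.symm h'
          have n4 : x⁻¹ ≠ (φ x)⁻¹ := fun e => n1 (inv_injective e)
          rw [Finset.card_insert_of_notMem (by simp [hxi, n1, n2]),
            Finset.card_insert_of_notMem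
              (by simp only [Finset.mem_insert, Finset.mem_singleton]; tauto),
            Finset.card_pair hne]
        rw [e] at this
        exact_mod_cast this
      simp only [hM, h, h', if_false]; linarith)
  have hsum : (Fintype.card Q : ℝ) ≤ ((n : ℝ) + m + Nat.card C + Nat.card D) / 4 := by
    refine hq.trans (le_of_eq ?_)
    rw [← Finset.sum_div]
    simp only [Finset.sum_add_distrib, Finset.sum_boole]
    have e1 : m = (Finset.univ.filter (fun x : A => x * x = 1)).card := by
      rw [hm, Nat.card_eq_fintype_card, Fintype.card_subtype]
    have e2 : Nat.card C = (Finset.univ.filter (fun x : A => φ x = x)).card := by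
      rw [← Fintype.card_subtype, ← Nat.card_eq_fintype_card]; rfl
    have e3 : Nat.card D = (Finset.univ.filter (fun x : A => φ x = x⁻¹)).card := by
      rw [← Fintype.card_subtype, ← Nat.card_eq_fintype_card]; rfl
    rw [← e1, ← e2, ← e3, hn]
    simp
  have hfin : (Fintype.card Q : ℝ) ≤ (m : ℝ) / 2 + 11 * n / 24 := by
    rw [Nat.card_eq_fintype_card (α := A), ← hn] at harith
    have : (6 : ℝ) * (Nat.card C + Nat.card D) ≤ 6 * m + 5 * n := by exact_mod_cast harith
    linarith
  calc (Nat.card {S : Set A // P S} : ℝ) ≤ (2 : ℝ) ^ Fintype.card Q := by exact_mod_cast hcard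
    _ = (2 : ℝ) ^ (Fintype.card Q : ℝ) := (Real.rpow_natCast _ _).symm
    _ ≤ _ := Real.rpow_le_rpow_of_exponent_le (by norm_num) hfin
end
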